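/- For f ∈ V_6 set k = (f,f)_4 and m = (f,k)_4. The four invariants f ↦ (f,f)_6, f ↦ (k,k)_4, f ↦ ((k,k)_2,k)_4 and f ↦ (m^2,(k,k)_2)_4, homogeneous of degrees 2, 4, 6 and 10 in the coefficients, form a homogeneous system of parameters of the algebra O(V_6)^{SL_2} of polynomial invariants of the binary sextic. -/

import Mathlib

open MvPolynomial

/-- The `k`-th transvectant of two binary forms `f` of degree `n` and `g` of degree `m`
(coefficients in a commutative `ℂ`-algebra `R`). -/
noncomputable def transv {R : Type} [CommRing R] [Algebra ℂ R] (n m k : ℕ)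
    (f g : MvPolynomial (Fin 2) R) : MvPolynomial (Fin 2) R :=
  ((((n - k).factorial * (m - k).factorial : ℕ) : ℂ) / ((n.factorial * m.factorial : ℕ) : ℂ)) •
    ∑ i ∈ Finset.range (k + 1),
      ((-1 : ℂ) ^ i * (k.choose i : ℂ)) •
        ((fun p => pderiv (0 : Fin 2) p)^[k - i] ((fun p => pderiv (1 : Fin 2) p)^[i] f) *
         (fun p => pderiv (0 : Fin 2) p)^[i] ((fun p => pderiv (1 : Fin 2) p)^[k - i] g))

/-- The binary form of degree `n` with coefficient vector `a`,
`f = ∑ binom(n,i) aᵢ x^(n-i) y^i`. -/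
noncomputable def formOf (n : ℕ) (a : Fin (n + 1) → ℂ) : MvPolynomial (Fin 2) ℂ :=
  ∑ i : Fin (n + 1), C ((n.choose (i : ℕ) : ℂ) * a i) * X 0 ^ (n - (i : ℕ)) * X 1 ^ (i : ℕ)

/-- The action of `SL₂(ℂ)` on binary forms: `(g · f)(v) = f (g⁻¹ v)`. -/
noncomputable def sl2Act (g : Matrix.SpecialLinearGroup (Fin 2) ℂ)
    (f : MvPolynomial (Fin 2) ℂ) : MvPolynomial (Fin 2) ℂ :=
  aeval (fun i => ∑ j,
    (((g⁻¹ : Matrix.SpecialLinearGroup (Fin 2) ℂ) : Matrix (Fin 2) (Fin 2) ℂ) i j) • X j) f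

/-- The coefficient vector of a binary form of degree `n`:
`aᵢ` is the coefficient of `x^(n-i) y^i` divided by `binom(n,i)`. -/
noncomputable def coeffOf (n : ℕ) (f : MvPolynomial (Fin 2) ℂ) (i : Fin (n + 1)) : ℂ :=
  coeff (Finsupp.single 0 (n - (i : ℕ)) + Finsupp.single 1 (i : ℕ)) f / (n.choose (i : ℕ) : ℂ)

/-- The graded algebra `O(V_n)^{SL₂}` of polynomial invariants of the binary form of
degree `n`: polynomials `P` in the coefficients `a₀, …, aₙ` such that `P` takes the same
value at the coefficients of `g · f` as at the coefficients of `f`, for every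
`g ∈ SL₂(ℂ)` and every `f ∈ Vₙ`. -/
noncomputable def invariantAlgebra (n : ℕ) : Subalgebra ℂ (MvPolynomial (Fin (n + 1)) ℂ) :=
  ⨅ p : Matrix.SpecialLinearGroup (Fin 2) ℂ × (Fin (n + 1) → ℂ),
    AlgHom.equalizer
      (aeval (coeffOf n (sl2Act p.1 (formOf n p.2))) : MvPolynomial (Fin (n + 1)) ℂ →ₐ[ℂ] ℂ)
      (aeval p.2)

/-- `v` is a homogeneous system of parameters of `O(V_n)^{SL₂}`: a family of homogeneous
invariants, algebraically independent over `ℂ`, such that `O(V_n)^{SL₂}` is a finitely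
generated module over the `ℂ`-subalgebra they generate. -/
def IsHSOP (n : ℕ) {ι : Type} [Fintype ι] (v : ι → MvPolynomial (Fin (n + 1)) ℂ) : Prop :=
  (∀ i, v i ∈ invariantAlgebra n) ∧
  (∀ i, ∃ d : ℕ, (v i).IsHomogeneous d) ∧
  AlgebraicIndependent ℂ v ∧
  ∃ F : Finset (MvPolynomial (Fin (n + 1)) ℂ),
    (F : Set (MvPolynomial (Fin (n + 1)) ℂ)) ⊆
      (invariantAlgebra n : Set (MvPolynomial (Fin (n + 1)) ℂ)) ∧
    ∀ x ∈ invariantAlgebra n,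
      x ∈ Submodule.span (Algebra.adjoin ℂ (Set.range v))
        (F : Set (MvPolynomial (Fin (n + 1)) ℂ))

/-- The generic binary form of degree `n`, with coefficients the variables
`a₀, …, aₙ` of the polynomial ring `ℂ[a₀, …, aₙ]`. -/
noncomputable def genForm (n : ℕ) : MvPolynomial (Fin 2) (MvPolynomial (Fin (n + 1)) ℂ) :=
  ∑ i : Fin (n + 1),
    MvPolynomial.C (MvPolynomial.C (n.choose (i : ℕ) : ℂ) * MvPolynomial.X i) *
      MvPolynomial.X (0 : Fin 2) ^ (n - (i : ℕ)) * MvPolynomial.X (1 : Fin 2) ^ (i : ℕ)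

/-- The covariant `k = (f,f)₄ ∈ V₄` of the generic binary sextic. -/
noncomputable def sexticK : MvPolynomial (Fin 2) (MvPolynomial (Fin 7) ℂ) :=
  transv 6 6 4 (genForm 6) (genForm 6)

/-- The covariant `m = (f,k)₄ ∈ V₂` of the generic binary sextic. -/
noncomputable def sexticM : MvPolynomial (Fin 2) (MvPolynomial (Fin 7) ℂ) :=
  transv 6 4 4 (genForm 6) sexticK

/-- The invariant `f ↦ (f,f)₆` of the binary sextic. -/
noncomputable def sexticI2 : MvPolynomial (Fin 7) ℂ :=
  coeff 0 (transv 6 6 6 (genForm 6) (genForm 6))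

/-- The invariant `f ↦ (k,k)₄` of the binary sextic. -/
noncomputable def sexticI4 : MvPolynomial (Fin 7) ℂ :=
  coeff 0 (transv 4 4 4 sexticK sexticK)

/-- The invariant `f ↦ ((k,k)₂,k)₄` of the binary sextic. -/
noncomputable def sexticI6 : MvPolynomial (Fin 7) ℂ :=
  coeff 0 (transv 4 4 4 (transv 4 4 2 sexticK sexticK) sexticK)

/-- The invariant `f ↦ (m²,(k,k)₂)₄` of the binary sextic. -/
noncomputable def sexticI10 : MvPolynomial (Fin 7) ℂ :=
  coeff 0 (transv 4 4 4 (sexticM ^ 2) (transv 4 4 2 sexticK sexticK))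

section ExplicitFormulas

variable {R : Type*} [CommRing R]

/-- Coefficients of `3 (f,f)₄` for the sextic `f` with coefficient vector `a`. -/
def sexticKCoeff (a : Fin 7 → R) : Fin 5 → R :=
  ![6 * (a 0 * a 4 - 4 * a 1 * a 3 + 3 * a 2 ^ 2),
    3 * (a 0 * a 5 - 3 * a 1 * a 4 + 2 * a 2 * a 3),
    a 0 * a 6 - 9 * a 2 * a 4 + 8 * a 3 ^ 2,
    3 * (a 1 * a 6 - 3 * a 2 * a 5 + 2 * a 3 * a 4),
    6 * (a 2 * a 6 - 4 * a 3 * a 5 + 3 * a 4 ^ 2)]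

/-- Coefficients of `(f,k)₄` for a sextic `f` and a quartic `k`. -/
def sexticMCoeff (a : Fin 7 → R) (k : Fin 5 → R) : Fin 3 → R :=
  ![a 0 * k 4 - 4 * a 1 * k 3 + 6 * a 2 * k 2 - 4 * a 3 * k 1 + a 4 * k 0,
    a 1 * k 4 - 4 * a 2 * k 3 + 6 * a 3 * k 2 - 4 * a 4 * k 1 + a 5 * k 0,
    a 2 * k 4 - 4 * a 3 * k 3 + 6 * a 4 * k 2 - 4 * a 5 * k 1 + a 6 * k 0]

/-- Coefficients of `3 (k,k)₂` for a quartic `k`. -/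
def quarticHCoeff (k : Fin 5 → R) : Fin 5 → R :=
  ![6 * (k 0 * k 2 - k 1 ^ 2), 3 * (k 0 * k 3 - k 1 * k 2),
    k 0 * k 4 + 2 * k 1 * k 3 - 3 * k 2 ^ 2,
    3 * (k 1 * k 4 - k 2 * k 3), 6 * (k 2 * k 4 - k 3 ^ 2)]

/-- The value of `(p,q)₄` for quartics `p` and `q`. -/
def quarticPairing (p q : Fin 5 → R) : R :=
  p 0 * q 4 - 4 * p 1 * q 3 + 6 * p 2 * q 2 - 4 * p 3 * q 1 + p 4 * q 0

/-- The value of `(m²,h)₄` for a quadratic `m` and a quartic `h`. -/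
def squarePairing (m : Fin 3 → R) (h : Fin 5 → R) : R :=
  m 0 ^ 2 * h 4 - 4 * m 0 * m 1 * h 3 + 2 * (m 0 * m 2 + 2 * m 1 ^ 2) * h 2
    - 4 * m 1 * m 2 * h 1 + m 2 ^ 2 * h 0

/-- The invariants `(f,f)₆`, `9 (k,k)₄`, `81 ((k,k)₂,k)₄` and `243 (m²,(k,k)₂)₄`
as explicit functions of the coefficient vector of `f`. -/
def sexticJ (a : Fin 7 → R) : Fin 4 → R :=
  ![2 * (a 0 * a 6 - 6 * a 1 * a 5 + 15 * a 2 * a 4 - 10 * a 3 ^ 2),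
    quarticPairing (sexticKCoeff a) (sexticKCoeff a),
    quarticPairing (quarticHCoeff (sexticKCoeff a)) (sexticKCoeff a),
    squarePairing (sexticMCoeff a (sexticKCoeff a)) (quarticHCoeff (sexticKCoeff a))]

/-- The binary form `∑ binom(n,i) cᵢ x^(n-i) y^i` over an arbitrary commutative ring. -/
noncomputable def binaryForm (n : ℕ) (c : ℕ → R) : MvPolynomial (Fin 2) R :=
  ∑ i ∈ Finset.range (n + 1), C ((n.choose i : R) * c i) * X 0 ^ (n - i) * X 1 ^ i

lemma pderiv_zero_binaryForm (n : ℕ) (c : ℕ → R) :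
    pderiv 0 (binaryForm (n + 1) c) = C (n + 1 : R) * binaryForm n c := by
  rw [binaryForm, Finset.sum_range_succ, binaryForm, Finset.mul_sum]
  simp only [map_add, map_sum, Derivation.leibniz, pderiv_C, Derivation.leibniz_pow]
  simp only [pderiv_X_self, pderiv_X_of_ne (show (1 : Fin 2) ≠ 0 by decide),
    tsub_self, zero_smul, smul_zero, smul_eq_mul, mul_one, mul_zero, add_zero, zero_add]
  refine Finset.sum_congr rfl fun i hi => ?_
  have h1 : n + 1 - i = n - i + 1 := by have := Finset.mem_range.mp hi; omega
  have h2 : ((n + 1).choose i : R) * (n - i + 1 : ℕ) = (n + 1 : R) * (n.choose i : R) := by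
    have := congrArg (Nat.cast : ℕ → R) (Nat.choose_mul_succ_eq n i)
    rw [h1, Nat.cast_mul, Nat.cast_mul] at this
    rw [← this]
    push_cast
    ring
  rw [h1, Nat.add_sub_cancel]
  have h3 := congrArg (C (σ := Fin 2)) h2
  simp only [map_mul, map_natCast, map_add, map_one, nsmul_eq_mul] at h3 ⊢
  linear_combination (X 1 ^ i * C (c i) * X 0 ^ (n - i)) * h3

lemma pderiv_one_binaryForm (n : ℕ) (c : ℕ → R) :
    pderiv 1 (binaryForm (n + 1) c) = C (n + 1 : R) * binaryForm n (fun i => c (i + 1)) := by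
  rw [binaryForm, Finset.sum_range_succ', binaryForm, Finset.mul_sum]
  simp only [map_add, map_sum, Derivation.leibniz, pderiv_C, Derivation.leibniz_pow]
  simp only [pderiv_X_self, pderiv_X_of_ne (show (0 : Fin 2) ≠ 1 by decide),
    zero_smul, smul_zero, smul_eq_mul, mul_one, mul_zero, add_zero]
  refine Finset.sum_congr rfl fun i hi => ?_
  have h2 : ((n + 1).choose (i + 1) : R) * (i + 1 : ℕ) = (n + 1 : R) * (n.choose i : R) := by
    have := congrArg (Nat.cast : ℕ → R) (Nat.add_one_mul_choose_eq n i)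
    rw [Nat.cast_mul, Nat.cast_mul] at this
    rw [← this]
    push_cast
    ring
  rw [Nat.add_sub_add_right, Nat.add_sub_cancel]
  have h3 := congrArg (C (σ := Fin 2)) h2
  simp only [map_mul, map_natCast, map_add, map_one, nsmul_eq_mul] at h3 ⊢
  linear_combination (X 1 ^ i * C (c (i + 1)) * X 0 ^ (n - i)) * h3

lemma iterate_pderiv_zero_binaryForm (n k : ℕ) (r : R) (c : ℕ → R) :
    (fun p => pderiv (0 : Fin 2) p)^[k] (C r * binaryForm (n + k) c) =
      C (r * (n + k).descFactorial k) * binaryForm n c := by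
  induction k generalizing r with
  | zero => simp
  | succ k ih =>
    rw [Function.iterate_succ_apply, ← add_assoc, pderiv_C_mul, pderiv_zero_binaryForm,
      ← mul_assoc, ← C_mul, ih, Nat.succ_descFactorial_succ]
    push_cast
    simp only [mul_assoc]

lemma iterate_pderiv_one_binaryForm (n k : ℕ) (r : R) (c : ℕ → R) :
    (fun p => pderiv (1 : Fin 2) p)^[k] (C r * binaryForm (n + k) c) =
      C (r * (n + k).descFactorial k) * binaryForm n (fun i => c (i + k)) := by
  induction k generalizing r c with
  | zero => simp
  | succ k ih =>
    rw [Function.iterate_succ_apply, ← add_assoc, pderiv_C_mul, pderiv_one_binaryForm,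
      ← mul_assoc, ← C_mul, ih, Nat.succ_descFactorial_succ]
    push_cast
    simp only [mul_assoc, add_assoc]

lemma iterate_pderiv_binaryForm (n i j : ℕ) (c : ℕ → R) :
    (fun p => pderiv (0 : Fin 2) p)^[i]
        ((fun p => pderiv (1 : Fin 2) p)^[j] (binaryForm (n + (i + j)) c)) =
      C ((n + (i + j)).descFactorial (i + j) : R) * binaryForm n (fun l => c (l + j)) := by
  have h := iterate_pderiv_one_binaryForm (n + i) j 1 c
  rw [C_1, one_mul, one_mul, add_assoc] at h
  rw [h, iterate_pderiv_zero_binaryForm, ← Nat.cast_mul]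
  congr 3
  rw [add_comm i j, ← Nat.descFactorial_mul_descFactorial (Nat.le_add_right j i), mul_comm,
    Nat.add_sub_cancel_left]
  congr 2
  omega

lemma genForm_eq_binaryForm (n : ℕ) :
    genForm n = binaryForm n (fun i => X (Fin.ofNat (n + 1) i)) := by
  rw [genForm, binaryForm, Finset.sum_range]
  simp

end ExplicitFormulas

section Transvectants

variable {R : Type} [CommRing R] [Algebra ℂ R]

lemma transv_binaryForm (n m k : ℕ) (a b : ℕ → R) :
    transv (n + k) (m + k) k (binaryForm (n + k) a) (binaryForm (m + k) b) =
      ∑ i ∈ Finset.range (k + 1), C ((-1) ^ i * (k.choose i : R)) *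
        (binaryForm n (fun l => a (l + i)) * binaryForm m (fun l => b (l + (k - i)))) := by
  have key : algebraMap ℂ (MvPolynomial (Fin 2) R)
      ((((n + k - k).factorial * (m + k - k).factorial : ℕ) : ℂ) /
        ((n + k).factorial * (m + k).factorial : ℕ)) *
      C ((n + k).descFactorial k * (m + k).descFactorial k : R) = 1 := by
    have h (l : ℕ) : ((l + k).descFactorial k : ℂ) = (l + k).factorial / l.factorial := by
      rw [eq_div_iff (by exact_mod_cast l.factorial_ne_zero), mul_comm]
      have := Nat.factorial_mul_descFactorial (Nat.le_add_left k l)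
      rw [Nat.add_sub_cancel] at this
      exact_mod_cast this
    have h' : (C ((n + k).descFactorial k * (m + k).descFactorial k : R) :
        MvPolynomial (Fin 2) R) = algebraMap ℂ (MvPolynomial (Fin 2) R)
          ((n + k).descFactorial k * (m + k).descFactorial k) := by
      simp
    rw [h', ← map_mul, ← map_one (algebraMap ℂ (MvPolynomial (Fin 2) R)), h, h,
      Nat.add_sub_cancel, Nat.add_sub_cancel]
    congr 1
    have := n.factorial_ne_zero
    have := m.factorial_ne_zero
    have := (n + k).factorial_ne_zero
    have := (m + k).factorial_ne_zero
    push_cast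
    field_simp
  rw [transv, Algebra.smul_def, Finset.mul_sum]
  refine Finset.sum_congr rfl fun i hi => ?_
  have hi' : i ≤ k := Finset.mem_range_succ_iff.mp hi
  have e1 := iterate_pderiv_binaryForm n (k - i) i a
  have e2 := iterate_pderiv_binaryForm m i (k - i) b
  rw [Nat.sub_add_cancel hi'] at e1
  rw [Nat.add_sub_cancel' hi'] at e2
  rw [e1, e2, Algebra.smul_def]
  simp only [map_mul, map_pow, map_neg, map_one, map_natCast] at key ⊢
  linear_combination ((-1) ^ i * (k.choose i : MvPolynomial (Fin 2) R) *
    (binaryForm n (fun l => a (l + i)) * binaryForm m (fun l => b (l + (k - i))))) * key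

end Transvectants

lemma C_ofNat {σ R : Type*} [CommSemiring R] (n : ℕ) [n.AtLeastTwo] :
    (C (ofNat(n)) : MvPolynomial σ R) = ofNat(n) :=
  map_ofNat C n

section Scaling

variable {R : Type*} [CommRing R]

/-- The binary form of degree `n` with coefficients given by a tuple. -/
noncomputable def tupleForm (n : ℕ) (c : Fin (n + 1) → R) :
    MvPolynomial (Fin 2) R :=
  binaryForm n (fun i => c (Fin.ofNat (n + 1) i))

lemma tupleForm_two_sq {t : R} (ht : 3 * t = 1) (m : Fin 3 → R) :
    tupleForm 2 m ^ 2 = tupleForm 4 ![m 0 ^ 2, m 0 * m 1, t * (m 0 * m 2 + 2 * m 1 ^ 2),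
      m 1 * m 2, m 2 ^ 2] := by
  have ht' := congrArg (C (σ := Fin 2)) ht
  rw [map_mul, map_ofNat, map_one] at ht'
  simp [Finset.sum_range_succ, binaryForm, tupleForm, Nat.choose, Fin.ofNat, C_ofNat]
  linear_combination (-2 * (C (m 0) * C (m 2) + 2 * C (m 1) ^ 2) * X 0 ^ 2 * X 1 ^ 2) * ht'

lemma sexticKCoeff_smul (s : R) (a : Fin 7 → R) :
    sexticKCoeff (s • a) = s ^ 2 • sexticKCoeff a := by
  funext i
  fin_cases i <;> simp [sexticKCoeff] <;> ring

lemma sexticMCoeff_smul (s t : R) (a : Fin 7 → R) (k : Fin 5 → R) :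
    sexticMCoeff (s • a) (t • k) = (s * t) • sexticMCoeff a k := by
  funext i
  fin_cases i <;> simp [sexticMCoeff] <;> ring

lemma quarticHCoeff_smul (t : R) (k : Fin 5 → R) :
    quarticHCoeff (t • k) = t ^ 2 • quarticHCoeff k := by
  funext i
  fin_cases i <;> simp [quarticHCoeff] <;> ring

lemma quarticPairing_smul (s t : R) (p q : Fin 5 → R) :
    quarticPairing (s • p) (t • q) = s * t * quarticPairing p q := by
  simp [quarticPairing]
  ring

lemma squarePairing_smul (s t : R) (m : Fin 3 → R) (h : Fin 5 → R) :
    squarePairing (s • m) (t • h) = s ^ 2 * t * squarePairing m h := by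
  simp [squarePairing]
  ring

lemma squarePairing_eq {t : R} (ht : 3 * t = 1) (m : Fin 3 → R) (h : Fin 5 → R) :
    quarticPairing ![m 0 ^ 2, m 0 * m 1, t * (m 0 * m 2 + 2 * m 1 ^ 2), m 1 * m 2, m 2 ^ 2] h =
      squarePairing m h := by
  simp only [quarticPairing, squarePairing, Matrix.cons_val]
  linear_combination (2 * h 2 * (m 0 * m 2 + 2 * m 1 ^ 2)) * ht

end Scaling

section SexticTransvectants

variable {R : Type} [CommRing R] [Algebra ℂ R]

lemma transv_six_six_four {t : R} (ht : 3 * t = 1) (a : Fin 7 → R) :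
    transv 6 6 4 (tupleForm 6 a) (tupleForm 6 a) =
      tupleForm 4 (fun i => t * sexticKCoeff a i) := by
  have ht' := congrArg (C (σ := Fin 2)) ht
  rw [map_mul, map_ofNat, map_one] at ht'
  rw [tupleForm, transv_binaryForm 2 2 4]
  simp [Finset.sum_range_succ, binaryForm, tupleForm, sexticKCoeff, Nat.choose, Fin.ofNat, C_ofNat]
  linear_combination
    (-2 * (C (a 0) * C (a 4) - 4 * C (a 1) * C (a 3) + 3 * C (a 2) ^ 2) * X 0 ^ 4
      - 4 * (C (a 0) * C (a 5) - 3 * C (a 1) * C (a 4) + 2 * C (a 2) * C (a 3)) * X 0 ^ 3 * X 1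
      - 2 * (C (a 0) * C (a 6) - 9 * C (a 2) * C (a 4) + 8 * C (a 3) ^ 2) * X 0 ^ 2 * X 1 ^ 2
      - 4 * (C (a 1) * C (a 6) - 3 * C (a 2) * C (a 5) + 2 * C (a 3) * C (a 4)) * X 0 * X 1 ^ 3
      - 2 * (C (a 2) * C (a 6) - 4 * C (a 3) * C (a 5) + 3 * C (a 4) ^ 2) * X 1 ^ 4) * ht'

lemma transv_six_four_four (a : Fin 7 → R) (k : Fin 5 → R) :
    transv 6 4 4 (tupleForm 6 a) (tupleForm 4 k) = tupleForm 2 (sexticMCoeff a k) := by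
  rw [tupleForm, tupleForm, transv_binaryForm 2 0 4]
  simp [Finset.sum_range_succ, binaryForm, tupleForm, sexticMCoeff, Nat.choose, Fin.ofNat, C_ofNat]
  ring

lemma transv_four_four_two {t : R} (ht : 3 * t = 1) (k : Fin 5 → R) :
    transv 4 4 2 (tupleForm 4 k) (tupleForm 4 k) =
      tupleForm 4 (fun i => t * quarticHCoeff k i) := by
  have ht' := congrArg (C (σ := Fin 2)) ht
  rw [map_mul, map_ofNat, map_one] at ht'
  rw [tupleForm, transv_binaryForm 2 2 2]
  simp [Finset.sum_range_succ, binaryForm, tupleForm, quarticHCoeff, Nat.choose, Fin.ofNat, C_ofNat]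
  linear_combination
    (-2 * (C (k 0) * C (k 2) - C (k 1) ^ 2) * X 0 ^ 4
      - 4 * (C (k 0) * C (k 3) - C (k 1) * C (k 2)) * X 0 ^ 3 * X 1
      - 2 * (C (k 0) * C (k 4) + 2 * C (k 1) * C (k 3) - 3 * C (k 2) ^ 2) * X 0 ^ 2 * X 1 ^ 2
      - 4 * (C (k 1) * C (k 4) - C (k 2) * C (k 3)) * X 0 * X 1 ^ 3
      - 2 * (C (k 2) * C (k 4) - C (k 3) ^ 2) * X 1 ^ 4) * ht'

lemma transv_four_four_four (p q : Fin 5 → R) :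
    transv 4 4 4 (tupleForm 4 p) (tupleForm 4 q) = C (quarticPairing p q) := by
  rw [tupleForm, tupleForm, transv_binaryForm 0 0 4]
  simp [Finset.sum_range_succ, binaryForm, quarticPairing, Nat.choose, Fin.ofNat, C_ofNat]
  ring

lemma transv_six_six_six (a : Fin 7 → R) :
    transv 6 6 6 (tupleForm 6 a) (tupleForm 6 a) = C (sexticJ a 0) := by
  rw [tupleForm, transv_binaryForm 0 0 6]
  simp [Finset.sum_range_succ, binaryForm, sexticJ, Nat.choose, Fin.ofNat, C_ofNat]
  ring

end SexticTransvectants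

section SexticInvariants

lemma three_mul_C_inv {σ : Type*} : (3 : MvPolynomial σ ℂ) * C (1 / 3) = 1 := by
  rw [← C_ofNat, ← C_mul, ← C_1]
  norm_num

lemma genForm_six : genForm 6 = tupleForm 6 (X : Fin 7 → MvPolynomial (Fin 7) ℂ) :=
  genForm_eq_binaryForm 6

lemma sexticK_eq :
    sexticK = tupleForm 4 ((C (1 / 3) : MvPolynomial (Fin 7) ℂ) • sexticKCoeff X) := by
  rw [sexticK, genForm_six, transv_six_six_four three_mul_C_inv]
  rfl

lemma sexticM_eq : sexticM =
    tupleForm 2 ((C (1 / 3) : MvPolynomial (Fin 7) ℂ) • sexticMCoeff X (sexticKCoeff X)) := by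
  rw [sexticM, genForm_six, sexticK_eq, transv_six_four_four]
  have h := sexticMCoeff_smul (1 : MvPolynomial (Fin 7) ℂ) (C (1 / 3)) X (sexticKCoeff X)
  rw [one_smul, one_mul] at h
  rw [h]

lemma transv_sexticK_sexticK : transv 4 4 2 sexticK sexticK =
    tupleForm 4 ((C (1 / 3) ^ 3 : MvPolynomial (Fin 7) ℂ) • quarticHCoeff (sexticKCoeff X)) := by
  rw [sexticK_eq, transv_four_four_two three_mul_C_inv]
  change tupleForm 4 ((C (1 / 3) : MvPolynomial (Fin 7) ℂ) • _) = _
  rw [quarticHCoeff_smul, smul_smul, ← pow_succ']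

lemma sexticI2_eq : sexticI2 = sexticJ X 0 := by
  rw [sexticI2, genForm_six, transv_six_six_six, coeff_zero_C]

lemma sexticI4_eq : sexticI4 = C (1 / 3) ^ 2 * sexticJ X 1 := by
  rw [sexticI4, sexticK_eq, transv_four_four_four, coeff_zero_C, quarticPairing_smul, ← sq]
  rfl

lemma sexticI6_eq : sexticI6 = C (1 / 3) ^ 4 * sexticJ X 2 := by
  rw [sexticI6, transv_sexticK_sexticK, sexticK_eq, transv_four_four_four, coeff_zero_C,
    quarticPairing_smul, ← pow_succ]
  rfl

lemma sexticI10_eq : sexticI10 = C (1 / 3) ^ 5 * sexticJ X 3 := by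
  rw [sexticI10, transv_sexticK_sexticK, sexticM_eq, tupleForm_two_sq three_mul_C_inv,
    transv_four_four_four, coeff_zero_C, squarePairing_eq three_mul_C_inv, squarePairing_smul,
    ← pow_add]
  rfl

end SexticInvariants

section Transformations

variable {R : Type*} [CommRing R]

/-- Coefficients of `f(x + t y, y)` for a quadratic `f`. -/
def quadraticShift (t : R) (m : Fin 3 → R) : Fin 3 → R :=
  ![m 0, m 1 + t * m 0, m 2 + 2 * t * m 1 + t ^ 2 * m 0]

/-- Coefficients of `f(x + t y, y)` for a quartic `f`. -/
def quarticShift (t : R) (k : Fin 5 → R) : Fin 5 → R :=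
  ![k 0, k 1 + t * k 0, k 2 + 2 * t * k 1 + t ^ 2 * k 0,
    k 3 + 3 * t * k 2 + 3 * t ^ 2 * k 1 + t ^ 3 * k 0,
    k 4 + 4 * t * k 3 + 6 * t ^ 2 * k 2 + 4 * t ^ 3 * k 1 + t ^ 4 * k 0]

/-- Coefficients of `f(x + t y, y)` for a sextic `f`. -/
def sexticShift (t : R) (a : Fin 7 → R) : Fin 7 → R :=
  ![a 0, a 1 + t * a 0, a 2 + 2 * t * a 1 + t ^ 2 * a 0,
    a 3 + 3 * t * a 2 + 3 * t ^ 2 * a 1 + t ^ 3 * a 0,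
    a 4 + 4 * t * a 3 + 6 * t ^ 2 * a 2 + 4 * t ^ 3 * a 1 + t ^ 4 * a 0,
    a 5 + 5 * t * a 4 + 10 * t ^ 2 * a 3 + 10 * t ^ 3 * a 2 + 5 * t ^ 4 * a 1 + t ^ 5 * a 0,
    a 6 + 6 * t * a 5 + 15 * t ^ 2 * a 4 + 20 * t ^ 3 * a 3 + 15 * t ^ 4 * a 2 + 6 * t ^ 5 * a 1
      + t ^ 6 * a 0]

/-- Coefficients of `f(x₀ x, y₀ y)` for a form `f` of degree `n` (with `m = n + 1`). -/
def diagScale {m : ℕ} (n : ℕ) (x y : R) (a : Fin m → R) : Fin m → R :=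
  fun i => x ^ (n - (i : ℕ)) * y ^ (i : ℕ) * a i

lemma sexticKCoeff_shift (t : R) (a : Fin 7 → R) :
    sexticKCoeff (sexticShift t a) = quarticShift t (sexticKCoeff a) := by
  funext i
  fin_cases i <;> simp [sexticKCoeff, sexticShift, quarticShift] <;> ring

lemma sexticMCoeff_shift (t : R) (a : Fin 7 → R) (k : Fin 5 → R) :
    sexticMCoeff (sexticShift t a) (quarticShift t k) = quadraticShift t (sexticMCoeff a k) := by
  funext i
  fin_cases i <;> simp [sexticMCoeff, sexticShift, quarticShift, quadraticShift] <;> ring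

lemma quarticHCoeff_shift (t : R) (k : Fin 5 → R) :
    quarticHCoeff (quarticShift t k) = quarticShift t (quarticHCoeff k) := by
  funext i
  fin_cases i <;> simp [quarticHCoeff, quarticShift] <;> ring

lemma quarticPairing_shift (t : R) (p q : Fin 5 → R) :
    quarticPairing (quarticShift t p) (quarticShift t q) = quarticPairing p q := by
  simp [quarticPairing, quarticShift]
  ring

lemma squarePairing_shift (t : R) (m : Fin 3 → R) (h : Fin 5 → R) :
    squarePairing (quadraticShift t m) (quarticShift t h) = squarePairing m h := by
  simp [squarePairing, quarticShift, quadraticShift]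
  ring

lemma sexticJ_shift (t : R) (a : Fin 7 → R) : sexticJ (sexticShift t a) = sexticJ a := by
  simp only [sexticJ, sexticKCoeff_shift, sexticMCoeff_shift, quarticHCoeff_shift,
    quarticPairing_shift, squarePairing_shift]
  congr 1
  simp [sexticShift]
  ring

lemma sexticKCoeff_rev (a : Fin 7 → R) :
    sexticKCoeff (fun i => a i.rev) = fun i => sexticKCoeff a i.rev := by
  funext i
  fin_cases i <;> simp [sexticKCoeff, Fin.rev] <;> ring

lemma sexticMCoeff_rev (a : Fin 7 → R) (k : Fin 5 → R) :
    sexticMCoeff (fun i => a i.rev) (fun i => k i.rev) = fun i => sexticMCoeff a k i.rev := by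
  funext i
  fin_cases i <;> simp [sexticMCoeff, Fin.rev] <;> ring

lemma quarticHCoeff_rev (k : Fin 5 → R) :
    quarticHCoeff (fun i => k i.rev) = fun i => quarticHCoeff k i.rev := by
  funext i
  fin_cases i <;> simp [quarticHCoeff, Fin.rev] <;> ring

lemma quarticPairing_rev (p q : Fin 5 → R) :
    quarticPairing (fun i => p i.rev) (fun i => q i.rev) = quarticPairing p q := by
  simp [quarticPairing, Fin.rev]
  ring

lemma squarePairing_rev (m : Fin 3 → R) (h : Fin 5 → R) :
    squarePairing (fun i => m i.rev) (fun i => h i.rev) = squarePairing m h := by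
  simp [squarePairing, Fin.rev]
  ring

lemma sexticJ_rev (a : Fin 7 → R) : sexticJ (fun i => a i.rev) = sexticJ a := by
  simp only [sexticJ, sexticKCoeff_rev, sexticMCoeff_rev, quarticHCoeff_rev,
    quarticPairing_rev, squarePairing_rev]
  congr 1
  simp [Fin.rev]
  ring

lemma sexticKCoeff_diagScale (x y : R) (a : Fin 7 → R) :
    sexticKCoeff (diagScale 6 x y a) = (x * y) ^ 4 • diagScale 4 x y (sexticKCoeff a) := by
  funext i
  fin_cases i <;> simp [sexticKCoeff, diagScale] <;> ring

lemma sexticMCoeff_diagScale (x y : R) (a : Fin 7 → R) (k : Fin 5 → R) :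
    sexticMCoeff (diagScale 6 x y a) (diagScale 4 x y k) =
      (x * y) ^ 4 • diagScale 2 x y (sexticMCoeff a k) := by
  funext i
  fin_cases i <;> simp [sexticMCoeff, diagScale] <;> ring

lemma quarticHCoeff_diagScale (x y : R) (k : Fin 5 → R) :
    quarticHCoeff (diagScale 4 x y k) = (x * y) ^ 2 • diagScale 4 x y (quarticHCoeff k) := by
  funext i
  fin_cases i <;> simp [quarticHCoeff, diagScale] <;> ring

lemma quarticPairing_diagScale (x y : R) (p q : Fin 5 → R) :
    quarticPairing (diagScale 4 x y p) (diagScale 4 x y q) =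
      (x * y) ^ 4 * quarticPairing p q := by
  simp [quarticPairing, diagScale]
  ring

lemma squarePairing_diagScale (x y : R) (m : Fin 3 → R) (h : Fin 5 → R) :
    squarePairing (diagScale 2 x y m) (diagScale 4 x y h) =
      (x * y) ^ 4 * squarePairing m h := by
  simp [squarePairing, diagScale]
  ring

/-- The degrees of the four invariants. -/
def sexticDegree : Fin 4 → ℕ := ![2, 4, 6, 10]

lemma sexticJ_smul (s : R) (a : Fin 7 → R) (d : Fin 4) :
    sexticJ (s • a) d = s ^ sexticDegree d * sexticJ a d := by
  have hM (a : Fin 7 → R) : sexticMCoeff (s • a) (s ^ 2 • sexticKCoeff a) =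
    (s * s ^ 2) • sexticMCoeff a (sexticKCoeff a) := sexticMCoeff_smul ..
  fin_cases d <;> simp only [sexticJ, sexticDegree, sexticKCoeff_smul, hM,
    quarticHCoeff_smul, quarticPairing_smul, squarePairing_smul] <;> simp <;> ring

lemma sexticJ_diagScale (x y : R) (a : Fin 7 → R) (d : Fin 4) :
    sexticJ (diagScale 6 x y a) d = ((x * y) ^ 3) ^ sexticDegree d * sexticJ a d := by
  have hM (k : Fin 5 → R) : sexticMCoeff (diagScale 6 x y a) ((x * y) ^ 4 • diagScale 4 x y k) =
      ((x * y) ^ 8) • diagScale 2 x y (sexticMCoeff a k) := by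
    have := sexticMCoeff_smul 1 ((x * y) ^ 4) (diagScale 6 x y a) (diagScale 4 x y k)
    rw [one_smul, one_mul] at this
    rw [this, sexticMCoeff_diagScale, smul_smul, ← pow_add]
  fin_cases d <;> simp only [sexticJ, sexticDegree, sexticKCoeff_diagScale, hM,
    quarticHCoeff_smul, quarticHCoeff_diagScale, smul_smul,
    quarticPairing_smul, squarePairing_smul, quarticPairing_diagScale,
    squarePairing_diagScale] <;> simp [diagScale] <;> ring

lemma map_sexticJ {S : Type*} [CommRing S] (φ : R →+* S) (a : Fin 7 → R) (d : Fin 4) :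
    φ (sexticJ a d) = sexticJ (fun i => φ (a i)) d := by
  fin_cases d <;> simp [sexticJ, sexticKCoeff, sexticMCoeff, quarticHCoeff, quarticPairing,
    squarePairing, map_ofNat]

end Transformations

section Weights

lemma coeff_aeval_C_mul_X {σ R : Type*} [CommRing R] (w : σ → R) (P : MvPolynomial σ R)
    (e : σ →₀ ℕ) :
    coeff e (aeval (fun i => C (w i) * X i) P) = (e.prod fun i k => w i ^ k) * coeff e P := by
  classical
  induction P using MvPolynomial.induction_on' with
  | monomial u r =>
    rw [aeval_monomial, algebraMap_eq]
    have : (u.prod fun i k => (C (w i) * X i : MvPolynomial σ R) ^ k) =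
        C (u.prod fun i k => w i ^ k) * monomial u 1 := by
      simp only [mul_pow, Finset.prod_mul_distrib, monomial_eq, C_1, one_mul, Finsupp.prod, map_prod,
        map_pow]
    rw [this, coeff_C_mul, coeff_C_mul, coeff_monomial, coeff_monomial]
    split_ifs with h
    · rw [h]; ring
    · simp
  | add p q hp hq => rw [map_add, coeff_add, hp, hq, coeff_add, mul_add]

lemma isHomogeneous_of_aeval_eq {σ : Type*} (P : MvPolynomial σ ℂ) (n : ℕ)
    (h : aeval (fun i => C 2 * X i) P = C (2 ^ n) * P) : P.IsHomogeneous n := by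
  intro e he
  have := congrArg (coeff e) h
  rw [coeff_aeval_C_mul_X (fun _ => 2), coeff_C_mul, mul_left_inj' he, Finsupp.prod,
    Finset.prod_pow_eq_pow_sum] at this
  rw [Finsupp.weight_apply, Finsupp.sum]
  simp only [Pi.one_apply, smul_eq_mul, mul_one]
  have h2 : (2 : ℕ) ^ (∑ i ∈ e.support, e i) = 2 ^ n := by exact_mod_cast this
  exact Nat.pow_right_injective le_rfl h2

lemma aeval_sexticJ {A : Type*} [CommRing A] [Algebra ℂ A] (b : Fin 7 → A) (d : Fin 4) :
    aeval b (sexticJ (X : Fin 7 → MvPolynomial (Fin 7) ℂ) d) = sexticJ b d := by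
  simpa using map_sexticJ (aeval b : MvPolynomial (Fin 7) ℂ →ₐ[ℂ] A).toRingHom X d

lemma sexticJ_isHomogeneous (d : Fin 4) :
    (sexticJ (X : Fin 7 → MvPolynomial (Fin 7) ℂ) d).IsHomogeneous (sexticDegree d) := by
  apply isHomogeneous_of_aeval_eq
  rw [aeval_sexticJ, map_pow, ← sexticJ_smul (C 2 : MvPolynomial (Fin 7) ℂ) X d]
  rfl

end Weights

section Membership

/-- Linear substitution of the variables of a binary form. -/
noncomputable def substForm (M : Matrix (Fin 2) (Fin 2) ℂ) :
    MvPolynomial (Fin 2) ℂ →ₐ[ℂ] MvPolynomial (Fin 2) ℂ :=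
  aeval (fun i => ∑ j, M i j • X j)

lemma sl2Act_eq_substForm (g : Matrix.SpecialLinearGroup (Fin 2) ℂ)
    (f : MvPolynomial (Fin 2) ℂ) :
    sl2Act g f = substForm (g⁻¹ : Matrix.SpecialLinearGroup (Fin 2) ℂ) f := rfl

lemma substForm_substForm (M N : Matrix (Fin 2) (Fin 2) ℂ) (f : MvPolynomial (Fin 2) ℂ) :
    substForm M (substForm N f) = substForm (N * M) f := by
  rw [← AlgHom.comp_apply]
  congr 1
  apply algHom_ext
  intro i
  simp [substForm, Matrix.mul_apply, add_smul, smul_smul]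
  abel

lemma coeffOf_formOf (n : ℕ) (a : Fin (n + 1) → ℂ) : coeffOf n (formOf n a) = a := by
  classical
  funext i
  have hm (j : Fin (n + 1)) (c : ℂ) : C c * X (0 : Fin 2) ^ (n - (j : ℕ)) * X 1 ^ (j : ℕ) =
      monomial (Finsupp.single 0 (n - (j : ℕ)) + Finsupp.single 1 (j : ℕ)) c := by
    rw [C_mul_X_pow_eq_monomial, X_pow_eq_monomial, monomial_mul, mul_one]
  have hi : ((n.choose i : ℕ) : ℂ) ≠ 0 := by
    exact_mod_cast (Nat.choose_pos (Nat.lt_succ_iff.mp i.2)).ne'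
  rw [coeffOf, formOf, coeff_sum, div_eq_iff hi, mul_comm (a i), Finset.sum_eq_single i]
  · rw [hm, coeff_monomial, if_pos rfl]
  · intro j _ hj
    rw [hm, coeff_monomial, if_neg]
    intro h
    have := DFunLike.congr_fun h 1
    simp at this
    exact hj (Fin.ext this)
  · simp

lemma substForm_shift (t : ℂ) (a : Fin 7 → ℂ) :
    substForm !![1, t; 0, 1] (formOf 6 a) = formOf 6 (sexticShift t a) := by
  simp [substForm, formOf, Fin.sum_univ_succ, sexticShift, Nat.choose, C_ofNat, smul_eq_C_mul]
  ring

lemma substForm_diag (x y : ℂ) (a : Fin 7 → ℂ) :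
    substForm !![x, 0; 0, y] (formOf 6 a) = formOf 6 (diagScale 6 x y a) := by
  simp [substForm, formOf, Fin.sum_univ_succ, diagScale, Nat.choose, smul_eq_C_mul]
  ring

lemma substForm_swap (a : Fin 7 → ℂ) :
    substForm !![0, 1; -1, 0] (formOf 6 a) =
      formOf 6 (diagScale 6 1 (-1) (fun i => a i.rev)) := by
  simp [substForm, formOf, Fin.sum_univ_succ, diagScale, Nat.choose, Fin.rev]
  ring

lemma SpecialLinearGroup.fin_two_induction {P : Matrix (Fin 2) (Fin 2) ℂ → Prop}
    (mul : ∀ M N, P M → P N → P (M * N)) (shift : ∀ t, P !![1, t; 0, 1])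
    (diag : ∀ x ≠ 0, P !![x, 0; 0, x⁻¹]) (swap : P !![0, 1; -1, 0])
    (g : Matrix.SpecialLinearGroup (Fin 2) ℂ) : P g := by
  obtain ⟨M, hM⟩ := g
  rw [Matrix.det_fin_two] at hM
  change P M
  by_cases hr : M 1 0 = 0
  · have hp : M 0 0 ≠ 0 := by rintro h; simp [h, hr] at hM
    have h : M = !![M 0 0, 0; 0, (M 0 0)⁻¹] * !![1, M 0 1 / M 0 0; 0, 1] := by
      ext i j
      fin_cases i <;> fin_cases j <;> simp [Matrix.mul_apply, hr]
      · field_simp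
      · exact eq_inv_of_mul_eq_one_left (by linear_combination hM + M 0 1 * hr)
    rw [h]
    exact mul _ _ (diag _ hp) (shift _)
  · have h : M = !![1, M 0 0 / M 1 0; 0, 1] * (!![0, 1; -1, 0] *
        (!![-M 1 0, 0; 0, (-M 1 0)⁻¹] * !![1, M 1 1 / M 1 0; 0, 1])) := by
      ext i j
      fin_cases i <;> fin_cases j <;> simp [Matrix.mul_apply]
      · field_simp
      · field_simp; linear_combination -hM
      · field_simp
    rw [h]
    exact mul _ _ (shift _) (mul _ _ swap (mul _ _ (diag _ (neg_ne_zero.mpr hr)) (shift _)))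

lemma exists_sl2Act_formOf (g : Matrix.SpecialLinearGroup (Fin 2) ℂ) (a : Fin 7 → ℂ) :
    ∃ b, sl2Act g (formOf 6 a) = formOf 6 b ∧ sexticJ b = sexticJ a := by
  rw [sl2Act_eq_substForm]
  refine SpecialLinearGroup.fin_two_induction
    (P := fun M => ∀ a, ∃ b, substForm M (formOf 6 a) = formOf 6 b ∧ sexticJ b = sexticJ a)
    ?_ ?_ ?_ ?_ g⁻¹ a
  · intro M N hM hN a
    obtain ⟨b, hb, hb'⟩ := hM a
    obtain ⟨c, hc, hc'⟩ := hN b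
    exact ⟨c, by rw [← substForm_substForm, hb, hc], hc'.trans hb'⟩
  · exact fun t a => ⟨_, substForm_shift t a, sexticJ_shift t a⟩
  · refine fun x hx a => ⟨_, substForm_diag x _ a, funext fun d => ?_⟩
    rw [sexticJ_diagScale, mul_inv_cancel₀ hx, one_pow, one_pow, one_mul]
  · refine fun a => ⟨_, substForm_swap a, funext fun d => ?_⟩
    rw [sexticJ_diagScale, sexticJ_rev]
    fin_cases d <;> norm_num [sexticDegree]

lemma sexticJ_mem_invariantAlgebra (d : Fin 4) :
    sexticJ (X : Fin 7 → MvPolynomial (Fin 7) ℂ) d ∈ invariantAlgebra 6 := by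
  simp only [invariantAlgebra, Algebra.mem_iInf, AlgHom.mem_equalizer]
  rintro ⟨g, a⟩
  obtain ⟨b, hb, hJ⟩ := exists_sl2Act_formOf g a
  rw [hb, coeffOf_formOf]
  rw [aeval_sexticJ, aeval_sexticJ, hJ]

end Membership

section InvariantsOverExtensions

lemma map_sexticShift {R S : Type*} [CommRing R] [CommRing S] (φ : R →+* S) (t : R)
    (a : Fin 7 → R) : (fun i => φ (sexticShift t a i)) = sexticShift (φ t) (fun i => φ (a i)) := by
  funext i
  fin_cases i <;> simp [sexticShift, map_ofNat]

lemma aeval_eq_of_mem_invariantAlgebra {P : MvPolynomial (Fin 7) ℂ}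
    (hP : P ∈ invariantAlgebra 6) {M : Matrix (Fin 2) (Fin 2) ℂ} (hM : M.det = 1)
    {a b : Fin 7 → ℂ} (h : substForm M (formOf 6 a) = formOf 6 b) : aeval b P = aeval a P := by
  simp only [invariantAlgebra, Algebra.mem_iInf, AlgHom.mem_equalizer] at hP
  let g : Matrix.SpecialLinearGroup (Fin 2) ℂ := ⟨M, hM⟩
  have hg : sl2Act g⁻¹ (formOf 6 a) = formOf 6 b := by
    rw [sl2Act_eq_substForm, inv_inv]
    exact h
  have := hP (g⁻¹, a)
  rwa [hg, coeffOf_formOf] at this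

lemma aeval_sexticShift {P : MvPolynomial (Fin 7) ℂ} (hP : P ∈ invariantAlgebra 6)
    {A : Type*} [CommRing A] [Algebra ℂ A] (t : A) (a : Fin 7 → A) :
    aeval (sexticShift t a) P = aeval a P := by
  have key : aeval (sexticShift (X none : MvPolynomial (Option (Fin 7)) ℂ) (fun i => X (some i))) P
      = aeval (fun i => (X (some i) : MvPolynomial (Option (Fin 7)) ℂ)) P := by
    apply MvPolynomial.funext
    intro c
    rw [← coe_aeval_eq_eval, RingHom.coe_coe, ← AlgHom.comp_apply, ← AlgHom.comp_apply,
      comp_aeval, comp_aeval]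
    have := map_sexticShift (aeval c : MvPolynomial (Option (Fin 7)) ℂ →ₐ[ℂ] ℂ).toRingHom (X none)
      (fun i => X (some i))
    simp only [AlgHom.toRingHom_eq_coe, RingHom.coe_coe, aeval_X] at this ⊢
    rw [this]
    exact aeval_eq_of_mem_invariantAlgebra hP (by simp) (substForm_shift (c none) _)
  have := congrArg (aeval (fun o : Option (Fin 7) => o.elim t a)) key
  rw [← AlgHom.comp_apply, ← AlgHom.comp_apply, comp_aeval, comp_aeval] at this
  have h := map_sexticShift (aeval (fun o : Option (Fin 7) => o.elim t a) :
    MvPolynomial (Option (Fin 7)) ℂ →ₐ[ℂ] A).toRingHom (X none) (fun i => X (some i))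
  simp only [AlgHom.toRingHom_eq_coe, RingHom.coe_coe, aeval_X, Option.elim] at this h
  rwa [h] at this

lemma prod_zpow_eq_zpow_sum {ι F : Type*} [Field F] {x : F} (hx : x ≠ 0) (s : Finset ι)
    (f : ι → ℤ) : ∏ i ∈ s, x ^ f i = x ^ ∑ i ∈ s, f i := by
  classical
  induction s using Finset.induction_on with
  | empty => simp
  | insert i s hi ih => rw [Finset.prod_insert hi, Finset.sum_insert hi, ih, zpow_add₀ hx]

lemma weight_eq_zero_of_mem_invariantAlgebra {P : MvPolynomial (Fin 7) ℂ}
    (hP : P ∈ invariantAlgebra 6) {e : Fin 7 →₀ ℕ} (he : e ∈ P.support) :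
    ∑ i : Fin 7, (6 - 2 * (i : ℤ)) * e i = 0 := by
  have key : aeval (fun i => C ((2 : ℂ) ^ (6 - 2 * ((i : Fin 7) : ℤ))) * X i) P = P := by
    apply MvPolynomial.funext
    intro c
    rw [← coe_aeval_eq_eval, RingHom.coe_coe, ← AlgHom.comp_apply, comp_aeval]
    have h := aeval_eq_of_mem_invariantAlgebra hP (by simp) (substForm_diag 2 2⁻¹ c)
    rw [← h]
    congr 2
    funext i
    fin_cases i <;> simp [diagScale, zpow_ofNat] <;> norm_num
  have h := congrArg (coeff e) key
  rw [coeff_aeval_C_mul_X, mul_left_eq_self₀, or_iff_left (mem_support_iff.mp he)] at h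
  rw [Finsupp.prod_fintype _ _ (by simp)] at h
  simp only [← zpow_natCast, ← zpow_mul] at h
  rw [prod_zpow_eq_zpow_sum two_ne_zero] at h
  have h2 := congrArg norm h
  rw [norm_zpow, Complex.norm_ofNat, norm_one] at h2
  rwa [zpow_eq_one_iff_right₀ zero_le_two (by norm_num)] at h2

lemma aeval_diagScale {P : MvPolynomial (Fin 7) ℂ} (hP : P ∈ invariantAlgebra 6)
    {A : Type*} [Field A] [Algebra ℂ A] {s : A} (hs : s ≠ 0) (a : Fin 7 → A) :
    aeval (diagScale 6 s s⁻¹ a) P = aeval a P := by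
  rw [aeval_def, aeval_def, eval₂_eq', eval₂_eq']
  refine Finset.sum_congr rfl fun e he => ?_
  congr 1
  have h := weight_eq_zero_of_mem_invariantAlgebra hP he
  have hd (i : Fin 7) : diagScale 6 s s⁻¹ a i = s ^ (6 - 2 * (i : ℤ)) * a i := by
    rw [diagScale, ← zpow_natCast, ← zpow_natCast, inv_zpow', ← zpow_add₀ hs]
    congr 2
    have := i.2
    omega
  simp only [hd, mul_pow, Finset.prod_mul_distrib]
  simp only [← zpow_natCast, ← zpow_mul]
  rw [prod_zpow_eq_zpow_sum hs, h, zpow_zero, one_mul]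

end InvariantsOverExtensions

section Nullcone

variable {F : Type*} [Field F] [CharZero F]

lemma exists_cusp_parameter {u v : F} (h : v ^ 2 = -4 * u ^ 3) :
    ∃ s, u = -s ^ 2 ∧ v = 2 * s ^ 3 := by
  by_cases hu : u = 0
  · refine ⟨0, by simp [hu], ?_⟩
    have : v ^ 2 = 0 := by rw [h, hu]; ring
    simpa using this
  · refine ⟨-v / (2 * u), ?_, ?_⟩
    · field_simp
      linear_combination h
    · field_simp
      linear_combination v * h

lemma quarticShift_quarticShift {R : Type*} [CommRing R] (s t : R) (k : Fin 5 → R) :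
    quarticShift s (quarticShift t k) = quarticShift (s + t) k := by
  funext i
  fin_cases i <;> simp [quarticShift] <;> ring

lemma sexticShift_sexticShift {R : Type*} [CommRing R] (s t : R) (a : Fin 7 → R) :
    sexticShift s (sexticShift t a) = sexticShift (s + t) a := by
  funext i
  fin_cases i <;> simp [sexticShift] <;> ring

/-- A quartic with vanishing invariants has a triple root. -/
lemma exists_quarticShift_eq_zero {k : Fin 5 → F} (hI : quarticPairing k k = 0)
    (hJ : quarticPairing (quarticHCoeff k) k = 0) :
    (k 0 = 0 ∧ k 1 = 0 ∧ k 2 = 0) ∨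
      ∃ t, quarticShift t k 2 = 0 ∧ quarticShift t k 3 = 0 ∧ quarticShift t k 4 = 0 := by
  have hI' (t : F) : quarticPairing (quarticShift t k) (quarticShift t k) = 0 := by
    rw [quarticPairing_shift, hI]
  have hJ' (t : F) :
      quarticPairing (quarticHCoeff (quarticShift t k)) (quarticShift t k) = 0 := by
    rw [quarticHCoeff_shift, quarticPairing_shift, hJ]
  by_cases h0 : k 0 = 0
  · by_cases h1 : k 1 = 0
    · left
      simp [quarticPairing, h0, h1] at hI
      exact ⟨h0, h1, hI⟩
    · right
      refine ⟨-k 2 / (2 * k 1), ?_⟩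
      have e0 : quarticShift (-k 2 / (2 * k 1)) k 0 = 0 := by simp [quarticShift, h0]
      have e1 : quarticShift (-k 2 / (2 * k 1)) k 1 ≠ 0 := by simpa [quarticShift, h0]
      have e2 : quarticShift (-k 2 / (2 * k 1)) k 2 = 0 := by
        simp [quarticShift, h0]
        field_simp
        ring
      specialize hI' (-k 2 / (2 * k 1))
      specialize hJ' (-k 2 / (2 * k 1))
      generalize quarticShift (-k 2 / (2 * k 1)) k = l at *
      simp [quarticPairing, e0, e2] at hI'
      have e3 : l 3 = 0 := by
        have : l 1 * l 3 = 0 := by linear_combination (-1 / 8) * hI'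
        simpa [e1] using this
      simp [quarticPairing, quarticHCoeff, e0, e2, e3] at hJ'
      have e4 : l 1 ^ 2 * l 4 = 0 := by linear_combination (-1 / 18) * hJ'
      exact ⟨e2, e3, by simpa [e1] using e4⟩
  · right
    have e0 : quarticShift (-k 1 / k 0) k 0 ≠ 0 := by simpa [quarticShift]
    have e1 : quarticShift (-k 1 / k 0) k 1 = 0 := by
      simp [quarticShift]
      field_simp
      ring
    specialize hI' (-k 1 / k 0)
    specialize hJ' (-k 1 / k 0)
    suffices ∃ s, quarticShift s (quarticShift (-k 1 / k 0) k) 2 = 0 ∧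
        quarticShift s (quarticShift (-k 1 / k 0) k) 3 = 0 ∧
        quarticShift s (quarticShift (-k 1 / k 0) k) 4 = 0 by
      obtain ⟨s, hs⟩ := this
      rw [quarticShift_quarticShift] at hs
      exact ⟨_, hs⟩
    generalize quarticShift (-k 1 / k 0) k = l at *
    simp [quarticPairing, e1] at hI'
    simp [quarticPairing, quarticHCoeff, e1] at hJ'
    have h4 : l 0 * l 4 = -3 * l 2 ^ 2 := by linear_combination (1 / 2) * hI'
    have hc : l 0 * l 3 ^ 2 = -4 * l 2 ^ 3 := by
      linear_combination (-1 / 18) * hJ' + l 2 * h4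
    obtain ⟨s, h2, h3⟩ := exists_cusp_parameter (u := l 2 / l 0) (v := l 3 / l 0) (by
      field_simp
      linear_combination hc)
    have h2' : l 2 = -s ^ 2 * l 0 := by rwa [div_eq_iff e0] at h2
    have h3' : l 3 = 2 * s ^ 3 * l 0 := by rwa [div_eq_iff e0] at h3
    have h4' : l 4 = -3 * s ^ 4 * l 0 := by
      apply mul_left_cancel₀ e0
      rw [h4, h2']
      ring
    refine ⟨s, ?_, ?_, ?_⟩ <;> simp [quarticShift, e1, h2', h3', h4'] <;> ring

/-- A sextic with vanishing invariants whose covariant `k` has a triple root at `(1 : 0)`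
has a root of multiplicity at least four. -/
lemma exists_sexticShift_eq_zero {a : Fin 7 → F} (h : sexticJ a = 0)
    (hk0 : sexticKCoeff a 0 = 0) (hk1 : sexticKCoeff a 1 = 0) (hk2 : sexticKCoeff a 2 = 0) :
    (a 0 = 0 ∧ a 1 = 0 ∧ a 2 = 0 ∧ a 3 = 0) ∨
      ∃ t, sexticShift t a 3 = 0 ∧ sexticShift t a 4 = 0 ∧ sexticShift t a 5 = 0 ∧
        sexticShift t a 6 = 0 := by
  have hJ (t : F) : sexticJ (sexticShift t a) = 0 := by rw [sexticJ_shift, h]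
  have hK0 (t : F) : sexticKCoeff (sexticShift t a) 0 = 0 := by
    rw [sexticKCoeff_shift]; simp [quarticShift, hk0]
  have hK1 (t : F) : sexticKCoeff (sexticShift t a) 1 = 0 := by
    rw [sexticKCoeff_shift]; simp [quarticShift, hk0, hk1]
  have hK2 (t : F) : sexticKCoeff (sexticShift t a) 2 = 0 := by
    rw [sexticKCoeff_shift]; simp [quarticShift, hk0, hk1, hk2]
  by_cases h0 : a 0 = 0
  · by_cases h1 : a 1 = 0
    · left
      simp [sexticKCoeff, h0, h1] at hk0
      simp [sexticKCoeff, h0, hk0] at hk2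
      exact ⟨h0, h1, hk0, hk2⟩
    · right
      refine ⟨-a 2 / (2 * a 1), ?_⟩
      have e0 : sexticShift (-a 2 / (2 * a 1)) a 0 = 0 := by simp [sexticShift, h0]
      have e1 : sexticShift (-a 2 / (2 * a 1)) a 1 ≠ 0 := by simpa [sexticShift, h0]
      have e2 : sexticShift (-a 2 / (2 * a 1)) a 2 = 0 := by
        simp [sexticShift, h0]
        field_simp
        ring
      specialize hJ (-a 2 / (2 * a 1))
      specialize hK0 (-a 2 / (2 * a 1))
      specialize hK1 (-a 2 / (2 * a 1))
      generalize sexticShift (-a 2 / (2 * a 1)) a = b at *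
      have e3 : b 3 = 0 := by simpa [sexticKCoeff, e0, e1, e2] using hK0
      have e4 : b 4 = 0 := by simpa [sexticKCoeff, e0, e1, e2, e3] using hK1
      have hJ0 := congrFun hJ 0
      have e5 : b 5 = 0 := by simpa [sexticJ, e0, e1, e2, e3] using hJ0
      have hJ3 := congrFun hJ 3
      have e6 : b 6 = 0 := by
        simpa [sexticJ, sexticKCoeff, sexticMCoeff, squarePairing, quarticHCoeff, e0, e1, e2, e3,
          e4, e5] using hJ3
      exact ⟨e3, e4, e5, e6⟩
  · right
    have e0 : sexticShift (-a 1 / a 0) a 0 ≠ 0 := by simpa [sexticShift]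
    have e1 : sexticShift (-a 1 / a 0) a 1 = 0 := by
      simp [sexticShift]
      field_simp
      ring
    specialize hJ (-a 1 / a 0)
    specialize hK0 (-a 1 / a 0)
    specialize hK1 (-a 1 / a 0)
    specialize hK2 (-a 1 / a 0)
    suffices ∃ s, sexticShift s (sexticShift (-a 1 / a 0) a) 3 = 0 ∧
        sexticShift s (sexticShift (-a 1 / a 0) a) 4 = 0 ∧
        sexticShift s (sexticShift (-a 1 / a 0) a) 5 = 0 ∧
        sexticShift s (sexticShift (-a 1 / a 0) a) 6 = 0 by
      obtain ⟨s, hs⟩ := this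
      rw [sexticShift_sexticShift] at hs
      exact ⟨_, hs⟩
    have hJ0 := congrFun hJ 0
    generalize sexticShift (-a 1 / a 0) a = b at *
    simp [sexticKCoeff, e1] at hK0 hK1 hK2
    simp [sexticJ, e1] at hJ0
    have hc : b 0 * b 3 ^ 2 = -4 * b 2 ^ 3 := by
      linear_combination (4 / 3) * b 2 * hK0 + (b 0 / 18) * (hK2 - hJ0)
    obtain ⟨s, h2, h3⟩ := exists_cusp_parameter (u := b 2 / b 0) (v := b 3 / b 0) (by
      field_simp
      linear_combination hc)
    have h2' : b 2 = -s ^ 2 * b 0 := by rwa [div_eq_iff e0] at h2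
    have h3' : b 3 = 2 * s ^ 3 * b 0 := by rwa [div_eq_iff e0] at h3
    have h4' : b 4 = -3 * s ^ 4 * b 0 := by
      apply mul_left_cancel₀ e0
      rw [h2'] at hK0
      linear_combination hK0
    have h5' : b 5 = 4 * s ^ 5 * b 0 := by
      apply mul_left_cancel₀ e0
      rw [h2', h3'] at hK1
      linear_combination hK1
    have h6' : b 6 = -5 * s ^ 6 * b 0 := by
      apply mul_left_cancel₀ e0
      rw [h2', h3', h4'] at hK2
      linear_combination hK2
    refine ⟨s, ?_, ?_, ?_, ?_⟩ <;> simp [sexticShift, e1, h2', h3', h4', h5', h6'] <;> ring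

/-- The nullcone: a property of sextics which is inherited along shifts and reversal, and which
holds for sextics divisible by `y⁴`, holds for all sextics with vanishing invariants. -/
lemma nullcone_induction {Q : (Fin 7 → F) → Prop} (shift : ∀ t a, Q (sexticShift t a) → Q a)
    (rev : ∀ a, Q (fun i => a i.rev) → Q a)
    (base : ∀ a, a 0 = 0 → a 1 = 0 → a 2 = 0 → a 3 = 0 → Q a)
    {a : Fin 7 → F} (h : sexticJ a = 0) : Q a := by
  have step (a : Fin 7 → F) (h : sexticJ a = 0) (h0 : sexticKCoeff a 0 = 0)
      (h1 : sexticKCoeff a 1 = 0) (h2 : sexticKCoeff a 2 = 0) : Q a := by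
    obtain ⟨e0, e1, e2, e3⟩ | ⟨t, e3, e4, e5, e6⟩ := exists_sexticShift_eq_zero h h0 h1 h2
    · exact base a e0 e1 e2 e3
    · exact shift t a (rev _ (base _ e6 e5 e4 e3))
  obtain ⟨e0, e1, e2⟩ | ⟨t, e2, e3, e4⟩ :=
    exists_quarticShift_eq_zero (k := sexticKCoeff a) (congrFun h 1) (congrFun h 2)
  · exact step a h e0 e1 e2
  · refine shift t a (rev _ (step _ ?_ ?_ ?_ ?_))
    · rw [sexticJ_rev, sexticJ_shift, h]
    all_goals rw [sexticKCoeff_rev, sexticKCoeff_shift]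
    exacts [e4, e3, e2]

end Nullcone

section Roots

variable {R : Type*} [CommRing R]

/-- The dehomogenization at `x = 1` of `∏ (pⱼ x - qⱼ y)`. -/
noncomputable def linProd {n : ℕ} (p q : Fin n → R) : Polynomial R :=
  ∏ j, (Polynomial.C (p j) - Polynomial.C (q j) * Polynomial.X)

/-- The coefficient vector of the sextic `60 ∏ (pⱼ x - qⱼ y)`. -/
noncomputable def sexticOfRoots (p q : Fin 6 → R) : Fin 7 → R :=
  fun i => ![60, 10, 4, 3, 4, 10, 60] i * (linProd p q).coeff i

/-- Multiplication of a coefficient sequence by `p x - q y`. -/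
def mulLinear (f : ℕ → R) (p q : R) : ℕ → R
  | 0 => f 0 * p
  | i + 1 => f (i + 1) * p - f i * q

lemma coeff_mul_linear (f : Polynomial R) (p q : R) :
    (f * (Polynomial.C p - Polynomial.C q * Polynomial.X)).coeff =
      mulLinear f.coeff p q := by
  funext i
  cases i with
  | zero => simp [mulLinear]
  | succ i =>
    rw [mul_sub, Polynomial.coeff_sub, Polynomial.coeff_mul_C, ← mul_assoc,
      Polynomial.coeff_mul_X, Polynomial.coeff_mul_C, mulLinear]

lemma coeff_linProd_six (p q : Fin 6 → R) : (linProd p q).coeff =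
    mulLinear (mulLinear (mulLinear (mulLinear (mulLinear (mulLinear (fun i => if i = 0 then 1 else 0)
      (p 0) (q 0)) (p 1) (q 1)) (p 2) (q 2)) (p 3) (q 3)) (p 4) (q 4)) (p 5) (q 5) := by
  rw [linProd, Fin.prod_univ_six]
  simp only [coeff_mul_linear]
  rw [← one_mul (Polynomial.C (p 0) - _), coeff_mul_linear]
  congr
  funext i
  rw [Polynomial.coeff_one]

lemma sexticOfRoots_eq (p q : Fin 6 → R) : sexticOfRoots p q = fun i =>
    ![60, 10, 4, 3, 4, 10, 60] i * mulLinear (mulLinear (mulLinear (mulLinear (mulLinear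
      (mulLinear (fun i => if i = 0 then 1 else 0) (p 0) (q 0)) (p 1) (q 1)) (p 2) (q 2))
        (p 3) (q 3)) (p 4) (q 4)) (p 5) (q 5) i := by
  rw [← coeff_linProd_six]
  rfl

lemma sexticOfRoots_shift (t : R) (p q : Fin 6 → R) :
    sexticOfRoots p (fun j => q j - t * p j) = sexticShift t (sexticOfRoots p q) := by
  funext i
  fin_cases i <;> simp [sexticOfRoots_eq, sexticShift, mulLinear] <;> ring

lemma sexticOfRoots_swap (p q : Fin 6 → R) :
    sexticOfRoots q p = fun i => sexticOfRoots p q i.rev := by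
  funext i
  fin_cases i <;> simp [sexticOfRoots_eq, mulLinear, Fin.rev] <;> ring

lemma sexticOfRoots_diagScale (x y : R) (p q : Fin 6 → R) :
    sexticOfRoots (fun j => x * p j) (fun j => y * q j) =
      diagScale 6 x y (sexticOfRoots p q) := by
  funext i
  fin_cases i <;> simp [sexticOfRoots_eq, mulLinear, diagScale] <;> ring

lemma linProd_mul {n : ℕ} (u p q : Fin n → R) :
    linProd (fun j => u j * p j) (fun j => u j * q j) = Polynomial.C (∏ j, u j) * linProd p q := by
  simp only [linProd, map_mul, map_prod, ← Finset.prod_mul_distrib]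
  exact Finset.prod_congr rfl fun j _ => by ring

lemma sexticOfRoots_mul (u p q : Fin 6 → R) :
    sexticOfRoots (fun j => u j * p j) (fun j => u j * q j) =
      (∏ j, u j) • sexticOfRoots p q := by
  funext i
  simp only [sexticOfRoots, linProd_mul, Polynomial.coeff_C_mul, Pi.smul_apply, smul_eq_mul]
  ring

lemma map_sexticOfRoots {S : Type*} [CommRing S] (φ : R →+* S) (p q : Fin 6 → R) (i : Fin 7) :
    φ (sexticOfRoots p q i) = sexticOfRoots (fun j => φ (p j)) (fun j => φ (q j)) i := by
  have h : linProd (fun j => φ (p j)) (fun j => φ (q j)) = (linProd p q).map φ := by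
    simp [linProd, Polynomial.map_prod]
  rw [sexticOfRoots, sexticOfRoots, h, Polynomial.coeff_map, map_mul]
  congr 1
  fin_cases i <;> simp [map_ofNat]

lemma four_le_card_of_linProd {F : Type*} [Field F] {n d : ℕ} {p q : Fin n → F}
    (hpq : ∀ j, p j = 0 → q j ≠ 0) (h : ∀ i < d, (linProd p q).coeff i = 0) :
    d ≤ Nat.card {j // p j = 0} := by
  classical
  rw [Nat.card_eq_fintype_card]
  have hd : Polynomial.X ^ d ∣ linProd p q := Polynomial.X_pow_dvd_iff.mpr h
  have hz : linProd p q = (∏ j : {j // p j = 0}, Polynomial.C (-q j)) *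
      (∏ j : {j // ¬ p j = 0}, (Polynomial.C (p j) - Polynomial.C (q j) * Polynomial.X)) *
      Polynomial.X ^ Fintype.card {j // p j = 0} := by
    rw [linProd, ← Fintype.prod_subtype_mul_prod_subtype (fun j => p j = 0), mul_right_comm]
    congr 1
    rw [← Finset.card_univ, ← Finset.prod_const, ← Finset.prod_mul_distrib]
    refine Finset.prod_congr rfl fun j _ => ?_
    rw [j.2]
    simp
  rw [hz] at hd
  by_contra hlt
  rw [not_le] at hlt
  have h1 := (pow_dvd_pow Polynomial.X (Nat.succ_le_of_lt hlt)).trans hd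
  rw [pow_succ', mul_dvd_mul_iff_right (pow_ne_zero _ Polynomial.X_ne_zero),
    Polynomial.X_dvd_iff, Polynomial.mul_coeff_zero, Polynomial.coeff_zero_prod,
    Polynomial.coeff_zero_prod, mul_eq_zero, Finset.prod_eq_zero_iff,
    Finset.prod_eq_zero_iff] at h1
  obtain ⟨j, -, hj⟩ | ⟨j, -, hj⟩ := h1
  · exact hpq j j.2 (by simpa using hj)
  · exact j.2 (by simpa using hj)

/-- If the invariants of a product of six nonzero linear forms vanish, then at least four of
the linear forms are proportional. -/
lemma exists_four_le_card {F : Type*} [Field F] [CharZero F] {p q : Fin 6 → F}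
    (hpq : ∀ j, p j = 0 → q j ≠ 0) (h : sexticJ (sexticOfRoots p q) = 0) :
    ∃ u v : F, (u = 0 → v ≠ 0) ∧ 4 ≤ Nat.card {j // p j * u = q j * v} := by
  refine nullcone_induction (Q := fun a => ∀ p q : Fin 6 → F, (∀ j, p j = 0 → q j ≠ 0) →
    sexticOfRoots p q = a → ∃ u v : F, (u = 0 → v ≠ 0) ∧ 4 ≤ Nat.card {j // p j * u = q j * v})
    ?_ ?_ ?_ h p q hpq rfl
  · rintro t a ih p q hpq rfl
    obtain ⟨u, v, huv, hc⟩ := ih p (fun j => q j - t * p j)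
      (fun j hj => by simpa [hj] using hpq j hj) (sexticOfRoots_shift t p q)
    refine ⟨u + t * v, v, fun hu hv => huv (by simpa [hv] using hu) hv, ?_⟩
    have e (j) : p j * (u + t * v) = q j * v ↔ p j * u = (q j - t * p j) * v := by
      constructor <;> intro h <;> linear_combination h
    simpa only [e] using hc
  · rintro a ih p q hpq rfl
    obtain ⟨u, v, huv, hc⟩ := ih q p (fun j hj hj' => hpq j hj' hj) (sexticOfRoots_swap p q)
    refine ⟨v, u, fun hu hv => huv hv hu, ?_⟩
    simpa only [eq_comm] using hc
  · rintro a h0 h1 h2 h3 p q hpq rfl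
    refine ⟨1, 0, by simp, ?_⟩
    have := four_le_card_of_linProd (d := 4) hpq (by
      simp only [sexticOfRoots] at h0 h1 h2 h3
      intro i hi
      interval_cases i
      · simpa using h0
      · simpa using h1
      · simpa using h2
      · simpa using h3)
    simpa only [mul_one, mul_zero] using this

end Roots

section ValuationRings

variable {K : Type*} [Field K]

/-- Among points of a valued field, choose a smallest disc containing three of them. -/
lemma exists_minimal_disc (V : ValuationSubring K) (z : Fin 6 → K) :
    ∃ i j, 3 ≤ Nat.card {l // V.valuation (z l - z i) ≤ V.valuation (z j - z i)} ∧
      ∀ i' j', 3 ≤ Nat.card {l // V.valuation (z l - z i') ≤ V.valuation (z j' - z i')} →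
        V.valuation (z j - z i) ≤ V.valuation (z j' - z i') := by
  let T : Set (Fin 6 × Fin 6) := {x | 3 ≤ Nat.card
    {l // V.valuation (z l - z x.1) ≤ V.valuation (z x.2 - z x.1)}}
  obtain ⟨j, hj⟩ := Finite.exists_max fun j => V.valuation (z j - z 0)
  have hT : T.Nonempty := ⟨(0, j), by simp [T, hj]⟩
  obtain ⟨x, hx, hmin⟩ := Set.exists_min_image T
    (fun x => V.valuation (z x.2 - z x.1)) T.toFinite hT
  exact ⟨x.1, x.2, hx, fun i' j' h => hmin (i', j') h⟩

lemma exists_balanced_disc (V : ValuationSubring K) {z : Fin 6 → K}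
    (hz : Function.Injective z) :
    ∃ t δ : K, δ ≠ 0 ∧ 3 ≤ Nat.card {l // (z l - t) / δ ∈ V} ∧
      ∀ S : Finset (Fin 6), 4 ≤ S.card →
        ∃ i ∈ S, ∃ j ∈ S, V.valuation δ ≤ V.valuation (z j - z i) := by
  obtain ⟨i, j, hij, hmin⟩ := exists_minimal_disc V z
  have hδ : z j - z i ≠ 0 := by
    intro h
    have : Subsingleton {l // V.valuation (z l - z i) ≤ V.valuation (z j - z i)} := by
      have key (l) (hl : V.valuation (z l - z i) ≤ V.valuation (z j - z i)) : l = i := by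
        rw [h, map_zero, le_zero_iff, map_eq_zero, sub_eq_zero] at hl
        exact hz hl
      exact ⟨fun a b => Subtype.ext ((key a a.2).trans (key b b.2).symm)⟩
    have := Finite.card_le_one_iff_subsingleton.mpr this
    omega
  refine ⟨z i, z j - z i, hδ, ?_, fun S hS => ?_⟩
  · convert hij using 4 with l
    rw [← V.valuation_le_one_iff, map_div₀, div_le_one₀]
    exact zero_lt_iff.mpr (by simpa using hδ)
  · obtain ⟨i', hi'⟩ : S.Nonempty := Finset.card_pos.mp (by omega)
    obtain ⟨j', hj', hmax⟩ := S.exists_max_image (fun l => V.valuation (z l - z i')) ⟨i', hi'⟩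
    refine ⟨i', hi', j', hj', hmin i' j' ?_⟩
    have : S.card ≤ Nat.card {l // V.valuation (z l - z i') ≤ V.valuation (z j' - z i')} := by
      rw [← Fintype.card_coe, ← Nat.card_eq_fintype_card]
      exact Nat.card_mono (Set.toFinite _) (fun l hl => hmax l hl)
    omega

/-- After an affine change of coordinate and rescaling, a product of linear forms with distinct
roots acquires a reduction with nonvanishing invariants. -/
lemma exists_isUnit_sexticJ (V : ValuationSubring K) [CharZero (IsLocalRing.ResidueField V)]
    {z : Fin 6 → K} (hz : Function.Injective z) :
    ∃ t δ : K, δ ≠ 0 ∧ ∃ (u : Fin 6 → K) (p q : Fin 6 → V),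
      (∀ l, 1 = u l * p l ∧ z l - t = δ * (u l * q l)) ∧
        ∃ d, IsUnit (sexticJ (sexticOfRoots p q) d) := by
  classical
  obtain ⟨t, δ, hδ, h3, hmin⟩ := exists_balanced_disc V hz
  have hloc (l : Fin 6) : ∃ (u : K) (p q : V), (1 = u * p ∧ (z l - t) / δ = u * q) ∧
      (IsLocalRing.residue V p = 0 → IsLocalRing.residue V q ≠ 0) ∧
      ((z l - t) / δ ∈ V → p = 1 ∧ u = 1) ∧
      ((z l - t) / δ ∉ V → IsLocalRing.residue V p = 0) := by
    by_cases hl : (z l - t) / δ ∈ V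
    · exact ⟨1, 1, ⟨_, hl⟩, by simp, by simp, by simp, by simp [hl]⟩
    · have h0 : (z l - t) / δ ≠ 0 := by
        intro h
        exact hl (h ▸ V.zero_mem)
      have hinv := (V.mem_or_inv_mem _).resolve_left hl
      refine ⟨(z l - t) / δ, ⟨_, hinv⟩, 1, ⟨(mul_inv_cancel₀ h0).symm, by simp⟩, by simp,
        by simp [hl], fun _ => ?_⟩
      rw [IsLocalRing.residue_eq_zero_iff, V.valuation_lt_one_iff]
      change V.valuation ((z l - t) / δ)⁻¹ < 1
      rw [map_inv₀, inv_lt_one₀ (zero_lt_iff.mpr (by simpa using h0)), ← not_le,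
        V.valuation_le_one_iff]
      exact hl
  choose u p q hpq hne hmem hnot using hloc
  refine ⟨t, δ, hδ, u, p, q, fun l => ⟨(hpq l).1, ?_⟩, ?_⟩
  · rw [← (hpq l).2, mul_div_cancel₀ _ hδ]
  by_contra! hunit
  have hJ : sexticJ (sexticOfRoots (fun l => IsLocalRing.residue V (p l))
      (fun l => IsLocalRing.residue V (q l))) = 0 := by
    funext d
    have := (IsLocalRing.residue_eq_zero_iff _).mpr ((IsLocalRing.mem_maximalIdeal _).mpr (hunit d))
    rw [map_sexticJ] at this
    simp only [map_sexticOfRoots] at this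
    exact this
  obtain ⟨a, b, hab, h4⟩ := exists_four_le_card hne hJ
  by_cases hb : b = 0
  · have ha : a ≠ 0 := fun h => hab h hb
    have hle : Nat.card {l // IsLocalRing.residue V (p l) * a = IsLocalRing.residue V (q l) * b} ≤
        Nat.card {l // ¬ (z l - t) / δ ∈ V} := by
      refine Nat.card_mono (Set.toFinite _) fun l (hl : _ = _) (hl' : _ ∈ V) => ?_
      rw [(hmem l hl').1, hb] at hl
      simp [ha] at hl
    have := Nat.card_eq_fintype_card (α := {l // (z l - t) / δ ∈ V})
    have := Nat.card_eq_fintype_card (α := {l // ¬ (z l - t) / δ ∈ V})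
    have := Fintype.card_subtype_compl (fun l => (z l - t) / δ ∈ V)
    have := Fintype.card_fin 6
    omega
  · have hin (l) (hl : IsLocalRing.residue V (p l) * a = IsLocalRing.residue V (q l) * b) :
        (z l - t) / δ ∈ V := by
      by_contra h
      have h0 := hnot l h
      rw [h0, zero_mul, eq_comm, mul_eq_zero] at hl
      exact hl.elim (hne l h0) hb
    let S : Finset (Fin 6) := Finset.univ.filter fun l =>
      IsLocalRing.residue V (p l) * a = IsLocalRing.residue V (q l) * b
    have hS : 4 ≤ S.card := by
      rwa [Nat.card_eq_fintype_card, Fintype.card_subtype] at h4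
    obtain ⟨i, hi, j, hj, hij⟩ := hmin S hS
    rw [Finset.mem_filter_univ] at hi hj
    obtain ⟨hpi, hui⟩ := hmem i (hin i hi)
    obtain ⟨hpj, huj⟩ := hmem j (hin j hj)
    rw [hpi, map_one, one_mul] at hi
    rw [hpj, map_one, one_mul, hi] at hj
    have hq : IsLocalRing.residue V (q j - q i) = 0 := by
      rw [map_sub, sub_eq_zero]
      exact (mul_right_cancel₀ hb hj).symm
    rw [IsLocalRing.residue_eq_zero_iff, V.valuation_lt_one_iff] at hq
    have hzz : z j - z i = δ * ((q j : K) - q i) := by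
      have h1 := (hpq i).2
      have h2 := (hpq j).2
      rw [hui, one_mul, div_eq_iff hδ] at h1
      rw [huj, one_mul, div_eq_iff hδ] at h2
      linear_combination h2 - h1
    rw [hzz, map_mul] at hij
    exact absurd hij (not_le.mpr
      (mul_lt_of_lt_one_right (zero_lt_iff.mpr (by simpa using hδ)) hq))

lemma sexticShift_smul {R : Type*} [CommRing R] (t c : R) (a : Fin 7 → R) :
    sexticShift t (c • a) = c • sexticShift t a := by
  funext i
  fin_cases i <;> simp [sexticShift] <;> ring

lemma diagScale_smul {R : Type*} [CommRing R] {m : ℕ} (n : ℕ) (x y c : R) (a : Fin m → R) :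
    diagScale n x y (c • a) = c • diagScale n x y a := by
  funext i
  simp only [diagScale, Pi.smul_apply, smul_eq_mul]
  ring

lemma exists_aeval_eq_aeval_smul [Algebra ℂ K] [IsAlgClosed K] (V : ValuationSubring K)
    [CharZero (IsLocalRing.ResidueField V)] {z : Fin 6 → K} (hz : Function.Injective z) (c : K) :
    ∃ (C : K) (h : Fin 7 → V), (∃ d, IsUnit (sexticJ h d)) ∧ ∀ P ∈ invariantAlgebra 6,
      aeval (c • sexticOfRoots (fun _ => 1) z) P = aeval (C • fun i => (h i : K)) P := by
  obtain ⟨t, δ, hδ, u, p, q, hpq, hd⟩ := exists_isUnit_sexticJ V hz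
  obtain ⟨s, rfl⟩ := IsAlgClosed.exists_pow_nat_eq δ (n := 2) (by norm_num)
  have hs : s ≠ 0 := by rintro rfl; simp at hδ
  refine ⟨c * ∏ l, s * u l, sexticOfRoots p q, hd, fun P hP => ?_⟩
  rw [← aeval_sexticShift hP t, sexticShift_smul, ← sexticOfRoots_shift,
    ← aeval_diagScale hP hs, diagScale_smul, ← sexticOfRoots_diagScale]
  have h1 : (fun _ : Fin 6 => s * 1) = fun l => s * u l * (p l : K) := by
    funext l
    rw [(hpq l).1, mul_assoc]
  have h2 : (fun l => s⁻¹ * (z l - t * 1)) = fun l => s * u l * (q l : K) := by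
    funext l
    rw [mul_one, (hpq l).2]
    field_simp
  have h3 : (fun i => ((sexticOfRoots p q i : V) : K)) =
      sexticOfRoots (fun l => (p l : K)) (fun l => (q l : K)) := by
    funext i
    exact map_sexticOfRoots V.subtype p q i
  rw [h1, h2, h3, sexticOfRoots_mul, smul_smul]

/-- If the basic invariants of a sextic with distinct roots are integral at a valuation, then so
are all invariants. -/
lemma aeval_mem_valuationSubring [Algebra ℂ K] [IsAlgClosed K] (V : ValuationSubring K)
    (hV : ∀ r : ℂ, algebraMap ℂ K r ∈ V) {z : Fin 6 → K} (hz : Function.Injective z) {c : K}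
    (hJ : ∀ d, sexticJ (c • sexticOfRoots (fun _ => 1) z) d ∈ V) {P : MvPolynomial (Fin 7) ℂ}
    (hP : P ∈ invariantAlgebra 6) : aeval (c • sexticOfRoots (fun _ => 1) z) P ∈ V := by
  have : CharZero (IsLocalRing.ResidueField V) :=
    charZero_of_injective_ringHom ((IsLocalRing.residue V).comp
      ((algebraMap ℂ K).codRestrict V.toSubring hV)).injective
  obtain ⟨C, h, ⟨d, hd⟩, hC⟩ := exists_aeval_eq_aeval_smul V hz c
  have hCV : C ∈ V := by
    have h1 := hC _ (sexticJ_mem_invariantAlgebra d)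
    rw [aeval_sexticJ, aeval_sexticJ, sexticJ_smul C] at h1
    have h2 := hJ d
    have h3 : ((sexticJ h d : V) : K) = sexticJ (fun i => (h i : K)) d :=
      map_sexticJ V.subtype h d
    rw [h1, ← h3, ← V.valuation_le_one_iff, map_mul, (V.valuation_eq_one_iff _).mp hd, mul_one,
      map_pow] at h2
    rw [← V.valuation_le_one_iff]
    refine (pow_le_one_iff ?_).mp h2
    fin_cases d <;> simp [sexticDegree]
  rw [hC P hP, aeval_def, eval₂_eq']
  refine V.toSubring.sum_mem fun e _ => V.mul_mem _ _ (hV _) ?_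
  exact V.toSubring.prod_mem fun i _ => V.toSubring.pow_mem (V.mul_mem _ _ hCV (h i).2) _

end ValuationRings

section Integrality

lemma isIntegral_of_forall_valuationSubring {B S K : Type*} [CommRing B] [CommRing S] [Field K]
    [Algebra B S] [Algebra B K] (φ : S →ₐ[B] K) (hφ : Function.Injective φ) {x : S}
    (h : ∀ V : ValuationSubring K, (∀ b, algebraMap B K b ∈ V) → φ x ∈ V) : IsIntegral B x := by
  rw [← isIntegral_algHom_iff φ hφ]
  by_contra hx
  have hcl : IsIntegrallyClosedIn (integralClosure B K).toSubring K :=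
    inferInstanceAs (IsIntegrallyClosedIn (integralClosure B K) K)
  obtain ⟨V, hV, hxV⟩ := Subring.exists_le_valuationSubring_of_isIntegrallyClosedIn
    (R := (integralClosure B K).toSubring) (x := φ x) hx
  exact hxV (h V fun b => hV (isIntegral_algebraMap (R := B) (x := b)))

lemma exists_eq_C_mul_linProd {F : Type*} [Field F] [IsAlgClosed F] {f : Polynomial F} {n : ℕ}
    (hn : f.natDegree = n) : ∃ z : Fin n → F,
      f = Polynomial.C f.leadingCoeff * linProd (fun j => -z j) (fun _ => -1) := by
  have hs := IsAlgClosed.splits f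
  have hcard : f.roots.toList.length = n := by
    rw [Multiset.length_toList, ← hn]
    exact hs.natDegree_eq_card_roots.symm
  subst hcard
  refine ⟨fun j => f.roots.toList[j.1], ?_⟩
  have hprod := hs.eq_prod_roots
  rw [← Multiset.coe_toList f.roots, Multiset.map_coe, Multiset.prod_coe,
    ← Fin.prod_univ_fun_getElem] at hprod
  refine hprod.trans (congrArg _ (Finset.prod_congr rfl fun j _ => ?_))
  rw [map_neg, map_neg, map_one]
  ring

lemma exists_eq_smul_sexticOfRoots {F : Type*} [Field F] [CharZero F] [IsAlgClosed F]
    {a : Fin 7 → F} (h0 : a 0 ≠ 0) :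
    ∃ (c : F) (z : Fin 6 → F), a = c • sexticOfRoots (fun _ => 1) z := by
  obtain ⟨f, hf⟩ : ∃ f : Polynomial F, f = ∑ i : Fin 7,
      Polynomial.C ((Nat.choose 6 i : F) * a i.rev) * Polynomial.X ^ (i : ℕ) := ⟨_, rfl⟩
  have hcoeff (i : Fin 7) : f.coeff i = (Nat.choose 6 i : F) * a i.rev := by
    simp only [hf, Polynomial.finsetSum_coeff, Polynomial.coeff_C_mul_X_pow, Fin.val_inj]
    simp
  have hdeg : f.natDegree = 6 := by
    apply Polynomial.natDegree_eq_of_le_of_coeff_ne_zero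
    · rw [hf]
      exact Polynomial.natDegree_sum_le_of_forall_le _ _ fun i _ =>
        (Polynomial.natDegree_C_mul_X_pow_le _ _).trans (by omega)
    · simpa using (hcoeff 6).trans_ne (by simpa using h0)
  have hlead : f.leadingCoeff = a 0 := by
    rw [Polynomial.leadingCoeff, hdeg]
    simpa using hcoeff 6
  obtain ⟨z, hz⟩ := exists_eq_C_mul_linProd hdeg
  rw [hlead] at hz
  refine ⟨a 0 / 60, z, ?_⟩
  have h1 := sexticOfRoots_mul (fun _ => -1) (fun _ => 1) z
  have h2 : sexticOfRoots (fun _ => 1) z = sexticOfRoots (fun _ => -1) (fun j => -z j) := by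
    simpa [show (-1 : F) ^ 6 = 1 by norm_num] using h1.symm
  have h3 (i : Fin 7) : a 0 * (linProd (fun j => -z j) (fun _ => -1)).coeff i =
      (Nat.choose 6 i : F) * a i.rev := by
    rw [← hcoeff, ← Polynomial.coeff_C_mul, ← hz]
  rw [h2, sexticOfRoots_swap]
  funext i
  have h4 := h3 i.rev
  rw [Fin.rev_rev] at h4
  simp only [Pi.smul_apply, smul_eq_mul, sexticOfRoots]
  have h5 : (![60, 10, 4, 3, 4, 10, 60] i.rev : F) * (Nat.choose 6 i.rev : F) = 60 := by
    fin_cases i <;> norm_num [Fin.rev, Nat.choose]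
  linear_combination (-![60, 10, 4, 3, 4, 10, 60] i.rev / 60 : F) * h4 - a i / 60 * h5

end Integrality

section InvariantsIntegral

/-- The coefficient vector of a sextic with generic leading coefficient and roots. -/
noncomputable def genericRootSextic : Fin 7 → MvPolynomial (Option (Fin 6)) ℂ :=
  (X none : MvPolynomial (Option (Fin 6)) ℂ) • sexticOfRoots (fun _ => 1) (fun j => X (some j))

lemma aeval_genericRootSextic {S : Type*} [CommRing S] [Algebra ℂ S] (c : S) (z : Fin 6 → S)
    (P : MvPolynomial (Fin 7) ℂ) :
    aeval (fun o : Option (Fin 6) => o.elim c z) (aeval genericRootSextic P) =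
      aeval (c • sexticOfRoots (fun _ => 1) z) P := by
  rw [← AlgHom.comp_apply, comp_aeval]
  congr 2
  funext i
  have := map_sexticOfRoots (aeval (fun o : Option (Fin 6) => o.elim c z) :
    MvPolynomial (Option (Fin 6)) ℂ →ₐ[ℂ] S).toRingHom (fun _ => 1) (fun j => X (some j)) i
  simp at this
  simp [genericRootSextic, this]

lemma aeval_sexticOfRoots_injective {K : Type*} [Field K] [Algebra ℂ K] {c : K} {z : Fin 6 → K}
    (h : AlgebraicIndependent ℂ (fun o : Option (Fin 6) => o.elim c z)) :
    Function.Injective (aeval (c • sexticOfRoots (fun _ => 1) z) :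
      MvPolynomial (Fin 7) ℂ →ₐ[ℂ] K) := by
  rw [injective_iff_map_eq_zero]
  intro P hP
  rw [← aeval_genericRootSextic] at hP
  have hP := (injective_iff_map_eq_zero _).1 h _ hP
  have hX : P * X 0 = 0 := by
    refine MvPolynomial.funext fun a => ?_
    rw [map_mul, eval_X, map_zero]
    by_cases h0 : a 0 = 0
    · rw [h0, mul_zero]
    · obtain ⟨c, z, rfl⟩ := exists_eq_smul_sexticOfRoots h0
      have := aeval_genericRootSextic c z P
      rw [hP, map_zero, aeval_eq_eval] at this
      exact (congrArg (· * _) this.symm).trans (zero_mul _)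
  exact (mul_eq_zero.1 hX).resolve_right (X_ne_zero 0)

lemma isIntegral_of_mem_invariantAlgebra {B : Subalgebra ℂ (MvPolynomial (Fin 7) ℂ)}
    (hB : ∀ d, sexticJ X d ∈ B) {P : MvPolynomial (Fin 7) ℂ} (hP : P ∈ invariantAlgebra 6) :
    IsIntegral B P := by
  let T := MvPolynomial (Option (Fin 6)) ℂ
  let K := AlgebraicClosure (FractionRing T)
  let x : Option (Fin 6) → K := fun o => algebraMap T K (X o)
  have hx : AlgebraicIndependent ℂ x :=
    (MvPolynomial.algebraicIndependent_X _ _).map' (f := IsScalarTower.toAlgHom ℂ T K)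
      (((algebraMap (FractionRing T) K).injective.comp (IsFractionRing.injective T _)))
  have hx' : AlgebraicIndependent ℂ (fun o : Option (Fin 6) => o.elim (x none) (fun j => x (some j))) := by
    convert hx using 1
    funext o
    cases o <;> rfl
  let ψ : MvPolynomial (Fin 7) ℂ →ₐ[ℂ] K :=
    aeval (x none • sexticOfRoots (fun _ => 1) (fun j => x (some j)))
  let _ : Algebra B K := (ψ.comp B.val).toRingHom.toAlgebra
  let φ : MvPolynomial (Fin 7) ℂ →ₐ[B] K := { ψ with commutes' := fun _ => rfl }
  refine isIntegral_of_forall_valuationSubring φ (aeval_sexticOfRoots_injective hx') fun V hV => ?_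
  refine aeval_mem_valuationSubring V (fun r => ?_) (z := fun j => x (some j))
    (fun i j hij => Option.some_injective _ (hx.injective hij)) (fun d => ?_) hP
  · have := hV (algebraMap ℂ B r)
    rwa [show algebraMap B K (algebraMap ℂ B r) = algebraMap ℂ K r from ψ.commutes r] at this
  · rw [← aeval_sexticJ]
    exact hV ⟨_, hB d⟩

end InvariantsIntegral

section Jacobian

variable {F : Type*} [Field F]

lemma pderiv_aeval {n : ℕ} (f : Fin n → MvPolynomial (Fin n) F) (p : MvPolynomial (Fin n) F)
    (j : Fin n) : pderiv j (aeval f p) = ∑ i, aeval f (pderiv i p) * pderiv j (f i) := by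
  induction p using MvPolynomial.induction_on with
  | C r => simp [algebraMap_eq]
  | add p q hp hq => simp only [map_add, hp, hq, add_mul, Finset.sum_add_distrib]
  | mul_X p k hp =>
    simp only [map_mul, aeval_X, Derivation.leibniz, hp, smul_eq_mul, map_add, add_mul,
      Finset.sum_add_distrib, pderiv_X, Finset.mul_sum]
    congr 1
    · simp [Pi.single_apply, apply_ite, ite_mul]
    · exact Finset.sum_congr rfl fun i _ => by ring

lemma totalDegree_pderiv_lt {σ : Type*} {p : MvPolynomial σ F} {i : σ} (h : pderiv i p ≠ 0) :
    (pderiv i p).totalDegree < p.totalDegree := by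
  obtain ⟨m, hm, hdeg⟩ := (pderiv i p).support.exists_mem_eq_sup (by simpa using h)
    (fun m => m.sum fun _ e => e)
  have hm' : m + Finsupp.single i 1 ∈ p.support := by
    rw [mem_support_iff, coeff_pderiv] at hm
    exact mem_support_iff.2 (left_ne_zero_of_mul hm)
  have h1 := le_totalDegree hm'
  rw [Finsupp.sum_add_index' (fun _ => rfl) (fun _ _ _ => rfl), Finsupp.sum_single_index rfl] at h1
  rw [totalDegree, hdeg]
  omega

lemma eq_C_of_pderiv_eq_zero [CharZero F] {σ : Type*} {p : MvPolynomial σ F}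
    (h : ∀ i, pderiv i p = 0) : p = C (coeff 0 p) := by
  classical
  ext m
  rw [coeff_C]
  split_ifs with hm
  · rw [← hm]
  · obtain ⟨i, hi⟩ := Finsupp.ne_iff.1 (Ne.symm hm)
    have h1 := congrArg (coeff (m - Finsupp.single i 1)) (h i)
    have h2 : m - Finsupp.single i 1 + Finsupp.single i 1 = m :=
      tsub_add_cancel_of_le (Finsupp.single_le_iff.2 (Nat.one_le_iff_ne_zero.2 hi))
    rw [coeff_pderiv, h2, coeff_zero] at h1
    exact (mul_eq_zero.1 h1).resolve_right (Nat.cast_add_one_ne_zero _)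

/-- The Jacobian criterion for algebraic independence. -/
lemma algebraicIndependent_of_det_pderiv_ne_zero [CharZero F] {n : ℕ}
    {f : Fin n → MvPolynomial (Fin n) F}
    (h : (Matrix.of fun i j => pderiv j (f i)).det ≠ 0) : AlgebraicIndependent F f := by
  rw [algebraicIndependent_iff]
  intro p
  induction hd : p.totalDegree using Nat.strong_induction_on generalizing p with
  | _ d ih =>
    subst hd
    intro hp
    have hw : (fun i => aeval f (pderiv i p)) = 0 := by
      refine Matrix.eq_zero_of_vecMul_eq_zero h (funext fun j => ?_)
      have := pderiv_aeval f p j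
      rw [hp, map_zero] at this
      simpa [Matrix.vecMul, dotProduct] using this.symm
    have hC := eq_C_of_pderiv_eq_zero (p := p) fun i => by
      by_contra hi
      exact hi (ih _ (totalDegree_pderiv_lt hi) _ rfl (congrFun hw i))
    rw [hC, aeval_C, algebraMap_eq, C_eq_zero] at hp
    rw [hC, hp, C_0]

end Jacobian

section Slice

/-- The coefficient vector of a sextic in a four-dimensional affine subspace. -/
noncomputable def sliceSextic : Fin 7 → MvPolynomial (Fin 4) ℂ :=
  ![0, 1, 0, X 0, X 1, X 2, X 3]

/-- The first order Taylor expansion at a point in the direction of the `j`-th coordinate. -/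
noncomputable def taylorHom (p : Fin 4 → ℂ) (j : Fin 4) :
    MvPolynomial (Fin 4) ℂ →ₐ[ℂ] DualNumber ℂ :=
  aeval fun i => TrivSqZeroExt.inl (p i) + TrivSqZeroExt.inr (if i = j then 1 else 0)

lemma taylorHom_apply (p : Fin 4 → ℂ) (j : Fin 4) (f : MvPolynomial (Fin 4) ℂ) :
    taylorHom p j f = TrivSqZeroExt.inl (eval p f) + TrivSqZeroExt.inr (eval p (pderiv j f)) := by
  induction f using MvPolynomial.induction_on with
  | C r => simp [taylorHom, TrivSqZeroExt.algebraMap_eq_inl]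
  | add f g hf hg => 
    simp only [map_add, hf, hg, TrivSqZeroExt.inl_add, TrivSqZeroExt.inr_add]
    ring
  | mul_X f k hf =>
    rw [map_mul, hf]
    rcases eq_or_ne k j with rfl | hk
    · ext
      · simp [taylorHom]
      · simp [taylorHom]
        ring
    · ext
      · simp [taylorHom, hk]
      · simp [taylorHom, pderiv_X_of_ne hk, hk]
        ring

lemma trivSqZeroExt_fst_ofNat (n : ℕ) [n.AtLeastTwo] :
    TrivSqZeroExt.fst (ofNat(n) : TrivSqZeroExt ℂ ℂ) = OfNat.ofNat n :=
  TrivSqZeroExt.fst_natCast n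

lemma trivSqZeroExt_snd_ofNat (n : ℕ) [n.AtLeastTwo] :
    TrivSqZeroExt.snd (ofNat(n) : TrivSqZeroExt ℂ ℂ) = 0 :=
  TrivSqZeroExt.snd_natCast n

lemma eval_pderiv_sexticJ_slice (j d : Fin 4) :
    eval ![0, 0, 0, 1] (pderiv j (sexticJ sliceSextic d)) =
      !![0, 0, -12, 0; 0, 216, 0, 0; 3888, 0, 0, 0; 0, 0, 0, -31104] d j := by
  have h := congrArg TrivSqZeroExt.snd (taylorHom_apply ![0, 0, 0, 1] j (sexticJ sliceSextic d))
  have h' := map_sexticJ (taylorHom ![0, 0, 0, 1] j).toRingHom sliceSextic d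
  simp at h h'
  rw [← h, h']
  fin_cases d <;> fin_cases j <;>
    (simp [taylorHom, sliceSextic, sexticJ, quarticPairing, squarePairing, sexticKCoeff,
      sexticMCoeff, quarticHCoeff, trivSqZeroExt_fst_ofNat, trivSqZeroExt_snd_ofNat] <;> norm_num)

lemma algebraicIndependent_sexticJ_slice : AlgebraicIndependent ℂ (sexticJ sliceSextic) := by
  refine algebraicIndependent_of_det_pderiv_ne_zero fun h => ?_
  have := congrArg (eval ![0, 0, 0, 1]) h
  rw [RingHom.map_det, map_zero, show (eval ![0, 0, 0, 1]).mapMatrix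
    (Matrix.of fun d j => pderiv j (sexticJ sliceSextic d)) = _ from
      Matrix.ext fun d j => eval_pderiv_sexticJ_slice j d] at this
  simp [Matrix.det_succ_row_zero, Fin.sum_univ_succ, Fin.succAbove] at this

end Slice

section FiniteGeneration

lemma finiteDimensional_of_essFiniteType {K L : Type*} [Field K] [Field L] [Algebra K L]
    [Algebra.EssFiniteType K L] [Algebra.IsAlgebraic K L] : FiniteDimensional K L := by
  obtain ⟨s, hs⟩ := IntermediateField.fg_top K L
  have := IntermediateField.finiteDimensional_adjoin (K := K) (S := (s : Set L))
    fun x _ => Algebra.IsIntegral.isIntegral x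
  rw [hs] at this
  exact Module.Finite.equiv (IntermediateField.topEquiv (F := K) (E := L)).toLinearEquiv

lemma fg_of_forall_isIntegral {B S L : Type*} [CommRing B] [IsDomain B] [IsNoetherianRing B]
    [IsIntegrallyClosed B] [CharZero B] [CommRing S] [IsDomain S] [Algebra B S] [Field L]
    [Algebra B L] [FaithfulSMul B L] [Algebra.IsAlgebraic B L] [Algebra.EssFiniteType B L]
    (θ : S →ₐ[B] L) {A : Submodule B S} (hA : ∀ x ∈ A, IsIntegral B x) : A.FG := by
  let K := FractionRing B
  let _ : Algebra K L := FractionRing.liftAlgebra B L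
  have : CharZero K := charZero_of_injective_algebraMap (IsFractionRing.injective B K)
  have : Algebra.EssFiniteType K L := Algebra.EssFiniteType.of_comp B K L
  have : Algebra.IsAlgebraic K L := (IsFractionRing.comap_isAlgebraic_iff (A := B)).1 inferInstance
  have : FiniteDimensional K L := finiteDimensional_of_essFiniteType
  have : IsNoetherian B (integralClosure B L) := IsIntegralClosure.isNoetherian B K L _
  let ψ : A →ₗ[B] integralClosure B L :=
    (θ.toLinearMap.comp A.subtype).codRestrict (Subalgebra.toSubmodule (integralClosure B L))
      fun x => (hA x x.2).map θ
  have hψ : Function.Injective ψ := by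
    rw [injective_iff_map_eq_zero]
    intro x hx
    have hx' : θ x = 0 := congrArg Subtype.val hx
    by_contra h0
    refine Ideal.comap_ne_bot_of_integral_mem (R := B) (I := RingHom.ker θ)
      (x := (x : S)) (by simpa using h0) hx' (hA x x.2) ?_
    rw [eq_bot_iff]
    intro b hb
    rw [Ideal.mem_comap, RingHom.mem_ker, AlgHom.commutes] at hb
    exact (FaithfulSMul.algebraMap_eq_zero_iff B L).1 hb
  have : IsNoetherian B A := isNoetherian_of_injective ψ hψ
  exact Module.Finite.iff_fg.1 inferInstance

end FiniteGeneration

section HomogeneousParameters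

lemma AlgebraicIndependent.smul_of_ne_zero {ι k A : Type*} [Field k] [CommRing A] [Algebra k A]
    {x : ι → A} (hx : AlgebraicIndependent k x) {r : ι → k} (hr : ∀ i, r i ≠ 0) :
    AlgebraicIndependent k (fun i => r i • x i) := by
  let φ : MvPolynomial ι k →ₐ[k] MvPolynomial ι k := aeval fun i => r i • X i
  let ψ : MvPolynomial ι k →ₐ[k] MvPolynomial ι k := aeval fun i => (r i)⁻¹ • X i
  have hφ : Function.Injective φ := by
    refine Function.LeftInverse.injective (g := ψ) fun p => ?_
    rw [← AlgHom.comp_apply, show ψ.comp φ = AlgHom.id k _ from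
      MvPolynomial.algHom_ext fun i => by simp [φ, ψ, hr i], AlgHom.id_apply]
  have h : aeval (fun i => r i • x i) = (aeval x).comp φ :=
    MvPolynomial.algHom_ext fun i => by simp [φ]
  rw [AlgebraicIndependent, h, AlgHom.coe_comp]
  exact Function.Injective.comp hx hφ

lemma algebraicIndependent_sexticJ :
    AlgebraicIndependent ℂ (sexticJ X : Fin 4 → MvPolynomial (Fin 7) ℂ) := by
  refine AlgebraicIndependent.of_comp (aeval sliceSextic) ?_
  convert algebraicIndependent_sexticJ_slice using 1
  exact funext fun d => aeval_sexticJ _ _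

lemma fg_of_isTranscendenceBasis {ι k R L : Type*} [Finite ι] [Field k] [CharZero k] [CommRing R]
    [IsDomain R] [Algebra k R] [Field L] [Algebra k L] [Algebra.EssFiniteType k L] {v : ι → R}
    (θ : R →ₐ[k] L) (hθ : IsTranscendenceBasis k (θ ∘ v))
    {A : Submodule (Algebra.adjoin k (Set.range v)) R}
    (hA : ∀ x ∈ A, IsIntegral (Algebra.adjoin k (Set.range v)) x) : A.FG := by
  let B := Algebra.adjoin k (Set.range v)
  have hv : AlgebraicIndependent k v := .of_comp θ hθ.1
  let _ : Algebra B L := (θ.comp B.val).toRingHom.toAlgebra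
  have : IsScalarTower k B L := IsScalarTower.of_algebraMap_eq fun x => (θ.commutes x).symm
  let e := hv.aevalEquiv
  have : IsNoetherianRing B := isNoetherianRing_of_ringEquiv _ e.toRingEquiv
  have : IsIntegrallyClosed B := IsIntegrallyClosed.of_equiv e.toRingEquiv
  have : CharZero B := charZero_of_injective_algebraMap (algebraMap k B).injective
  have : FaithfulSMul B L := by
    rw [faithfulSMul_iff_algebraMap_injective, injective_iff_map_eq_zero]
    intro b hb
    obtain ⟨p, rfl⟩ := e.surjective b
    have hp : aeval (θ ∘ v) p = 0 := by
      rw [← hb]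
      change _ = θ (algebraMap (Algebra.adjoin k (Set.range v)) R (hv.aevalEquiv p))
      rw [hv.algebraMap_aevalEquiv p, ← AlgHom.comp_apply, comp_aeval]
      rfl
    rw [(injective_iff_map_eq_zero _).1 hθ.1 p hp, map_zero]
  have : Algebra.IsAlgebraic B L := by
    rw [hθ.isAlgebraic_iff]
    exact fun d => isAlgebraic_algebraMap
      (⟨v d, Algebra.subset_adjoin (Set.mem_range_self d)⟩ : B)
  have : Algebra.EssFiniteType B L := Algebra.EssFiniteType.of_comp k B L
  exact fg_of_forall_isIntegral (B := B) { θ with commutes' := fun _ => rfl } hA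

lemma fg_of_algebraicIndependent_aeval {ι σ k : Type*} [Finite ι] [Field k] [CharZero k]
    {v : ι → MvPolynomial σ k} {s : σ → MvPolynomial ι k}
    (hv : AlgebraicIndependent k (aeval s ∘ v))
    {A : Submodule (Algebra.adjoin k (Set.range v)) (MvPolynomial σ k)}
    (hA : ∀ x ∈ A, IsIntegral (Algebra.adjoin k (Set.range v)) x) : A.FG := by
  have hb : IsTranscendenceBasis k (aeval s ∘ v) :=
    hv.isTranscendenceBasis_of_lift_trdeg_le_of_finite (by simp [MvPolynomial.trdeg_of_isDomain])
  have : Algebra.IsAlgebraic (MvPolynomial ι k) (FractionRing (MvPolynomial ι k)) :=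
    IsLocalization.isAlgebraic _ (nonZeroDivisors _)
  have hL := hb.algebraMap_comp (A := FractionRing (MvPolynomial ι k))
  have : Algebra.EssFiniteType (MvPolynomial ι k) (FractionRing (MvPolynomial ι k)) :=
    Algebra.EssFiniteType.of_isLocalization _ (nonZeroDivisors _)
  have : Algebra.EssFiniteType k (FractionRing (MvPolynomial ι k)) :=
    Algebra.EssFiniteType.comp k (MvPolynomial ι k) _
  exact fg_of_isTranscendenceBasis
    ((IsScalarTower.toAlgHom k (MvPolynomial ι k) (FractionRing (MvPolynomial ι k))).comp (aeval s))
    hL hA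

lemma exists_finset_span_invariantAlgebra {v : Fin 4 → MvPolynomial (Fin 7) ℂ} {r : Fin 4 → ℂ}
    (hr : ∀ d, r d ≠ 0) (hv : ∀ d, v d = r d • sexticJ X d) :
    ∃ F : Finset (MvPolynomial (Fin 7) ℂ),
      (F : Set (MvPolynomial (Fin 7) ℂ)) ⊆ invariantAlgebra 6 ∧
      ∀ x ∈ invariantAlgebra 6,
        x ∈ Submodule.span (Algebra.adjoin ℂ (Set.range v)) (F : Set (MvPolynomial (Fin 7) ℂ)) := by
  let B := Algebra.adjoin ℂ (Set.range v)
  have hB : B ≤ invariantAlgebra 6 := by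
    refine Algebra.adjoin_le ?_
    rintro _ ⟨d, rfl⟩
    rw [hv]
    exact Subalgebra.smul_mem _ (sexticJ_mem_invariantAlgebra d) _
  have hJ : ∀ d, sexticJ X d ∈ B := fun d => by
    have := B.smul_mem (Algebra.subset_adjoin (Set.mem_range_self d)) (r d)⁻¹
    rwa [hv, inv_smul_smul₀ (hr d)] at this
  have hvs : (aeval sliceSextic ∘ v) = fun d => r d • sexticJ sliceSextic d := by
    funext d
    rw [Function.comp_apply, hv, map_smul, aeval_sexticJ]
  let A : Submodule B (MvPolynomial (Fin 7) ℂ) :=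
    { (invariantAlgebra 6).toSubmodule with
      smul_mem' := fun b _ hx => (invariantAlgebra 6).mul_mem (hB b.2) hx }
  obtain ⟨F, hF⟩ := fg_of_algebraicIndependent_aeval (A := A) (s := sliceSextic)
    (hvs ▸ algebraicIndependent_sexticJ_slice.smul_of_ne_zero hr)
    fun x hx => isIntegral_of_mem_invariantAlgebra hJ hx
  refine ⟨F, fun x hx => ?_, fun x hx => ?_⟩
  · have : x ∈ A := hF ▸ Submodule.subset_span hx
    exact this
  · have : x ∈ A := hx
    rwa [← hF] at this

lemma isHSOP_of_eq_smul {v : Fin 4 → MvPolynomial (Fin 7) ℂ} {r : Fin 4 → ℂ}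
    (hr : ∀ d, r d ≠ 0) (hv : ∀ d, v d = r d • sexticJ X d) :
    (∀ d, (v d).IsHomogeneous (sexticDegree d)) ∧ IsHSOP 6 v := by
  have hd : ∀ d, (v d).IsHomogeneous (sexticDegree d) := fun d => by
    rw [hv, smul_eq_C_mul]
    exact (sexticJ_isHomogeneous d).C_mul _
  refine ⟨hd, fun d => ?_, fun d => ⟨_, hd d⟩, ?_, exists_finset_span_invariantAlgebra hr hv⟩
  · rw [hv]
    exact Subalgebra.smul_mem _ (sexticJ_mem_invariantAlgebra d) _
  · rw [funext hv]
    exact algebraicIndependent_sexticJ.smul_of_ne_zero hr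

end HomogeneousParameters

/-- For `f ∈ V₆`, set `k = (f,f)₄` and `m = (f,k)₄`. The four invariants `f ↦ (f,f)₆`,
`f ↦ (k,k)₄`, `f ↦ ((k,k)₂,k)₄` and `f ↦ (m²,(k,k)₂)₄`, homogeneous of degrees
2, 4, 6 and 10 in the coefficients, form a homogeneous system of parameters of the
algebra `O(V₆)^{SL₂}` of polynomial invariants of the binary sextic. -/
theorem sextic_hsop :
    sexticI2.IsHomogeneous 2 ∧ sexticI4.IsHomogeneous 4 ∧
    sexticI6.IsHomogeneous 6 ∧ sexticI10.IsHomogeneous 10 ∧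
    IsHSOP 6 ![sexticI2, sexticI4, sexticI6, sexticI10] := by
  have h₂ : sexticI2 = (1 : ℂ) • sexticJ X 0 := by rw [sexticI2_eq, one_smul]
  have h₄ : sexticI4 = ((1 / 3) ^ 2 : ℂ) • sexticJ X 1 := by
    rw [sexticI4_eq, smul_eq_C_mul, map_pow]
  have h₆ : sexticI6 = ((1 / 3) ^ 4 : ℂ) • sexticJ X 2 := by
    rw [sexticI6_eq, smul_eq_C_mul, map_pow]
  have h₁₀ : sexticI10 = ((1 / 3) ^ 5 : ℂ) • sexticJ X 3 := by
    rw [sexticI10_eq, smul_eq_C_mul, map_pow]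
  generalize sexticI2 = I₂ at *
  generalize sexticI4 = I₄ at *
  generalize sexticI6 = I₆ at *
  generalize sexticI10 = I₁₀ at *
  obtain ⟨hd, hsop⟩ := isHSOP_of_eq_smul (v := ![I₂, I₄, I₆, I₁₀])
    (r := ![1, (1 / 3) ^ 2, (1 / 3) ^ 4, (1 / 3) ^ 5])
    (by simp [Fin.forall_fin_succ])
    (by
      simp only [Fin.forall_fin_succ]
      exact ⟨h₂, h₄, h₆, h₁₀, fun i => i.elim0⟩)
  exact ⟨hd 0, hd 1, hd 2, hd 3, hsop⟩
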